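/- arXiv:1802.00170 — 13 statements merged into one kernel-verified Lean document; each statement's English description precedes it below -/
import Mathlib

section
/- For every real number ρ with 1 < ρ there exist z₀ > 0, T > 0 and a solution (x, y, z) of the soliton ODE system on [0, T] with initial condition x(0) = 0, y(0) = 1, z(0) = z₀, such that x(t) ≥ 0 for all t ∈ [0, T], x(T) = 0, y(T) < 0, and |y(T)| = ρ (i.e. the ratio of the boundary slopes |y(T)|/y(0) equals ρ). -/
/-- A solution of the soliton ODE system `x' = y`, `y' = x·y − z²`, `z' = x·z`
on a set `I ⊆ ℝ`: the three functions are differentiable at every point of `I`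
with the prescribed derivatives. -/
def IsSolitonODESolution (x y z : ℝ → ℝ) (I : Set ℝ) : Prop :=
  ∀ t ∈ I, HasDerivAt x (y t) t ∧ HasDerivAt y (x t * y t - (z t) ^ 2) t ∧
    HasDerivAt z (x t * z t) t

/-- A scalar autonomous equation `q' = W(q)` with `W` continuous, positive and bounded has a
strictly increasing global solution through any initial value, and it takes every real value. -/
theorem exists_strictMono_surjective_solution (W : ℝ → ℝ) (M q₀ : ℝ) (hW : Continuous W)
    (hpos : ∀ s, 0 < W s) (hM : ∀ s, W s ≤ M) :
    ∃ q : ℝ → ℝ, q 0 = q₀ ∧ StrictMono q ∧ Function.Surjective q ∧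
      ∀ t, HasDerivAt q (W (q t)) t := by
  have hMpos : 0 < M := (hpos 0).trans_le (hM 0)
  have hcont : Continuous fun s => (W s)⁻¹ := hW.inv₀ fun s => (hpos s).ne'
  set F : ℝ → ℝ := fun s => ∫ u in q₀..s, (W u)⁻¹
  have hder : ∀ s, HasDerivAt F (W s)⁻¹ s := fun s =>
    (hcont.integral_hasStrictDerivAt q₀ s).hasDerivAt
  have hmono : StrictMono F := strictMono_of_deriv_pos fun s => by
    rw [(hder s).deriv]; exact inv_pos.2 (hpos s)
  have hFc : Continuous F := continuous_iff_continuousAt.2 fun s => (hder s).continuousAt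
  have hF0 : F q₀ = 0 := intervalIntegral.integral_same
  have hderG : ∀ s, HasDerivAt (fun s => F s - s * M⁻¹) ((W s)⁻¹ - M⁻¹) s := fun s => by
    have h := (hder s).sub ((hasDerivAt_id s).mul_const M⁻¹)
    rw [one_mul] at h
    exact h
  have hG : Monotone fun s => F s - s * M⁻¹ :=
    monotone_of_deriv_nonneg (fun s => (hderG s).differentiableAt) fun s => by
      rw [(hderG s).deriv]
      exact sub_nonneg.2 (inv_anti₀ (hpos s) (hM s))
  have htop : Filter.Tendsto F Filter.atTop Filter.atTop := by
    refine Filter.tendsto_atTop_mono' _ ?_ (Filter.tendsto_atTop_add_const_left _ (-q₀ * M⁻¹)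
      (Filter.tendsto_id.atTop_mul_const (inv_pos.2 hMpos)))
    filter_upwards [Filter.eventually_ge_atTop q₀] with s hs
    have := hG hs
    simp only [hF0, id] at this ⊢
    linarith
  have hbot : Filter.Tendsto F Filter.atBot Filter.atBot := by
    refine Filter.tendsto_atBot_mono' _ ?_ (Filter.tendsto_atBot_add_const_left _ (-q₀ * M⁻¹)
      (Filter.tendsto_id.atBot_mul_const (inv_pos.2 hMpos)))
    filter_upwards [Filter.eventually_le_atBot q₀] with s hs
    have := hG hs
    simp only [hF0, id] at this ⊢
    linarith
  let e : ℝ ≃o ℝ := hmono.orderIsoOfSurjective F (hFc.surjective htop hbot)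
  have he : ∀ s, F (e.symm s) = s := fun s => e.apply_symm_apply s
  refine ⟨e.symm, ?_, e.symm.strictMono, e.symm.surjective, fun t => ?_⟩
  · exact hmono.injective ((he 0).trans hF0.symm)
  · simpa using HasDerivAt.of_local_left_inverse e.symm.continuous.continuousAt
      (hder (e.symm t)) (inv_pos.2 (hpos _)).ne' (Filter.Eventually.of_forall he)

/-- For every `ρ > 1` there is a solution of the soliton ODE system starting at
`(0, 1, z₀)` for some `z₀ > 0`, with `x ≥ 0` on `[0, T]`, `x(T) = 0`, `y(T) < 0`
and `|y(T)| = ρ`. -/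
theorem soliton_ODE_existence (ρ : ℝ) (hρ : 1 < ρ) :
    ∃ (z₀ T : ℝ) (x y z : ℝ → ℝ), 0 < z₀ ∧ 0 < T ∧
      IsSolitonODESolution x y z (Set.Icc 0 T) ∧
      x 0 = 0 ∧ y 0 = 1 ∧ z 0 = z₀ ∧
      (∀ t ∈ Set.Icc 0 T, 0 ≤ x t) ∧ x T = 0 ∧ y T < 0 ∧ |y T| = ρ := by
  -- With `q = -y / z` the system has the first integral `x + q² / 2`, satisfies `q' = z`, and
  -- `z` is a cubic polynomial in `q`; the slope ratio is then `1 + 2 * a ^ 4 / 3`, `a = 1 / z₀`.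
  obtain ⟨a, ha, haρ⟩ : ∃ a : ℝ, 0 < a ∧ 1 + 2 * a ^ 4 / 3 = ρ := by
    refine ⟨√√(3 * (ρ - 1) / 2), by apply Real.sqrt_pos.2; apply Real.sqrt_pos.2; linarith, ?_⟩
    rw [show (4 : ℕ) = 2 * 2 from rfl, pow_mul, Real.sq_sqrt (Real.sqrt_nonneg _),
      Real.sq_sqrt (by linarith)]
    ring
  set P : ℝ → ℝ := fun q => a⁻¹ + (q + a) ^ 2 * (2 * a - q) / 6 with hP
  set c : ℝ → ℝ := fun q => max (-a) (min q a) with hc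
  have hc_le : ∀ q, c q ≤ a := fun q => max_le (by linarith) (min_le_right _ _)
  have hc_ge : ∀ q, -a ≤ c q := fun q => le_max_left _ _
  have hc_eq : ∀ q, -a ≤ q → q ≤ a → c q = q := fun q h₁ h₂ => by
    simp only [hc, min_eq_left h₂, max_eq_right h₁]
  have hP' : ∀ q, HasDerivAt P ((a ^ 2 - q ^ 2) / 2) q := fun q => by
    have h := (((((hasDerivAt_id q).add_const a).pow 2).mul
      ((hasDerivAt_id q).const_sub (2 * a))).div_const 6).const_add a⁻¹
    refine h.congr_deriv ?_
    norm_num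
    ring
  obtain ⟨q, hq0, hqm, hqs, hqd⟩ := exists_strictMono_surjective_solution (fun s => P (c s))
    (a⁻¹ + (2 * a) ^ 2 * (3 * a) / 6) (-a) (by fun_prop)
    (fun s => by
      have h₁ := hc_le s
      have : 0 ≤ 2 * a - c s := by linarith
      simp only [hP]
      positivity)
    (fun s => by
      have h₁ := hc_le s
      have h₂ := hc_ge s
      have h₃ : (c s + a) ^ 2 ≤ (2 * a) ^ 2 := pow_le_pow_left₀ (by linarith) (by linarith) 2
      have h₄ := mul_le_mul h₃ (show 2 * a - c s ≤ 3 * a by linarith) (by linarith)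
        (by positivity)
      simp only [hP]
      linarith)
  obtain ⟨T, hT⟩ := hqs a
  have hTpos : 0 < T := hqm.lt_iff_lt.1 (by rw [hq0, hT]; linarith)
  have hlo : ∀ t ∈ Set.Icc 0 T, -a ≤ q t := fun t ht => hq0 ▸ hqm.monotone ht.1
  have hhi : ∀ t ∈ Set.Icc 0 T, q t ≤ a := fun t ht => hT ▸ hqm.monotone ht.2
  have hyT : -q T * P (q T) = -ρ := by
    rw [hT, ← haρ]
    simp only [hP]
    field_simp
    ring
  refine ⟨a⁻¹, T, fun t => (a ^ 2 - q t ^ 2) / 2, fun t => -q t * P (q t), fun t => P (q t),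
    inv_pos.2 ha, hTpos, fun t ht => ?_, ?_, ?_, ?_, fun t ht => ?_, ?_, ?_, ?_⟩
  · have hq := hqd t
    simp only [hc_eq _ (hlo t ht) (hhi t ht)] at hq
    have hz : HasDerivAt (fun t => P (q t)) ((a ^ 2 - q t ^ 2) / 2 * P (q t)) t :=
      (hP' (q t)).comp t hq
    refine ⟨?_, ?_, hz⟩
    · refine (((hq.pow 2).const_sub (a ^ 2)).div_const 2).congr_deriv ?_
      norm_num
      ring
    · refine (hq.neg.mul hz).congr_deriv ?_
      simp only [Pi.neg_apply]
      ring
  · simp [hq0]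
  · simp [hq0, hP, ha.ne']
  · simp [hq0, hP]
  · have h := abs_le.2 ⟨hlo t ht, hhi t ht⟩
    have := sq_le_sq' (hlo t ht) (hhi t ht)
    simp only
    linarith
  · simp [hT]
  · simp only [hyT]
    linarith
  · simp only [hyT, abs_neg]
    exact abs_of_pos (by linarith)
end

section
/- For all real numbers c₁, c₂ with 0 < c₁ < c₂ there exist T > 0, z₀ > 0 and a solution (x, y, z) of the soliton ODE system on [0, T] with x(0) = 0, x(T) = 0, x(t) ≥ 0 for all t ∈ [0, T], z(0) = z₀ > 0, y(0) = c₁ and y(T) = −c₂. (This follows from the ρ-parametrized existence result together with the scaling symmetry (x, y, z)(t) ↦ (λ x(λt), λ² y(λt), λ^{3/2} z(λt)) of the system.) -/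
/-- A scalar autonomous equation `r' = F r` whose continuous right-hand side is bounded between
two positive constants has a global solution through every point, and it is an increasing
bijection of the line. -/
theorem exists_autonomous_solution {F : ℝ → ℝ} (hF : Continuous F) {m M : ℝ} (hm : 0 < m)
    (hmF : ∀ r, m ≤ F r) (hFM : ∀ r, F r ≤ M) (a : ℝ) :
    ∃ r : ℝ → ℝ, r 0 = a ∧ StrictMono r ∧ Function.Surjective r ∧
      ∀ t, HasDerivAt r (F (r t)) t := by
  have hpos : ∀ r, 0 < F r := fun r => hm.trans_le (hmF r)
  have hM : 0 < M := (hpos a).trans_le (hFM a)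
  have hinv : Continuous fun s => (F s)⁻¹ := hF.inv₀ fun s => (hpos s).ne'
  set G : ℝ → ℝ := fun r => ∫ s in a..r, (F s)⁻¹
  have hG : ∀ r, HasDerivAt G (F r)⁻¹ r := fun r => hinv.integral_hasStrictDerivAt a r |>.hasDerivAt
  have hGa : G a = 0 := intervalIntegral.integral_same
  have hGc : Continuous G := continuous_iff_continuousAt.2 fun r => (hG r).continuousAt
  have hGmono : StrictMono G := strictMono_of_deriv_pos fun r => by
    rw [(hG r).deriv]; exact inv_pos.2 (hpos r)
  have hdiff : Monotone fun r => G r - M⁻¹ * r := by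
    have hd : ∀ r, HasDerivAt (fun r => G r - M⁻¹ * r) ((F r)⁻¹ - M⁻¹ * 1) r := fun r =>
      (hG r).sub ((hasDerivAt_id r).const_mul M⁻¹)
    refine monotone_of_deriv_nonneg (fun r => (hd r).differentiableAt) fun r => ?_
    rw [(hd r).deriv, mul_one, sub_nonneg]
    exact inv_anti₀ (hpos r) (hFM r)
  have hlin : ∀ c, Filter.Tendsto (fun r : ℝ => M⁻¹ * r + c) Filter.atTop Filter.atTop ∧
      Filter.Tendsto (fun r : ℝ => M⁻¹ * r + c) Filter.atBot Filter.atBot := fun c =>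
    ⟨Filter.tendsto_atTop_add_const_right _ _
        (Filter.tendsto_id.const_mul_atTop (inv_pos.2 hM)),
      Filter.tendsto_atBot_add_const_right _ _
        (Filter.tendsto_id.const_mul_atBot (inv_pos.2 hM))⟩
  have htop : Filter.Tendsto G Filter.atTop Filter.atTop := by
    refine Filter.tendsto_atTop_mono' _ ?_ (hlin (-(M⁻¹ * a))).1
    filter_upwards [Filter.eventually_ge_atTop a] with r hr
    have := hdiff hr
    simp only [hGa] at this
    linarith
  have hbot : Filter.Tendsto G Filter.atBot Filter.atBot := by
    refine Filter.tendsto_atBot_mono' _ ?_ (hlin (-(M⁻¹ * a))).2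
    filter_upwards [Filter.eventually_le_atBot a] with r hr
    have := hdiff hr
    simp only [hGa] at this
    linarith
  let e := hGmono.orderIsoOfSurjective G (hGc.surjective htop hbot)
  have he : ∀ t, G (e.symm t) = t := e.apply_symm_apply
  refine ⟨e.symm, ?_, e.symm.strictMono, e.symm.surjective, fun t => ?_⟩
  · rw [← hGa]
    exact e.symm_apply_apply a
  · have := HasDerivAt.of_local_left_inverse (e.symm.continuous.continuousAt (x := t))
      (hG (e.symm t)) (inv_ne_zero (hpos _).ne') (Filter.Eventually.of_forall he)
    rwa [inv_inv] at this

/-- Solutions of `r' = Z(r)`, for a cubic `Z` with `Z' = (q² - r²) / 2`, give solutions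
`x = (q² - r²) / 2`, `y = -r z`, `z = Z(r)` of the soliton system, on which `x + (y / z)² / 2` is
constant. -/
theorem isSolitonODESolution_of_cubic {r : ℝ → ℝ} {q k : ℝ} {I : Set ℝ}
    (hr : ∀ t ∈ I, HasDerivAt r (k + (r t + q) ^ 2 * (2 * q - r t) / 6) t) :
    IsSolitonODESolution (fun t => (q ^ 2 - r t ^ 2) / 2)
      (fun t => -r t * (k + (r t + q) ^ 2 * (2 * q - r t) / 6))
      (fun t => k + (r t + q) ^ 2 * (2 * q - r t) / 6) I := by
  intro t ht
  have h := hr t ht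
  have hz : HasDerivAt (fun s => k + (r s + q) ^ 2 * (2 * q - r s) / 6)
      ((q ^ 2 - r t ^ 2) / 2 * (k + (r t + q) ^ 2 * (2 * q - r t) / 6)) t := by
    refine ((((h.add_const q).fun_pow 2).fun_mul (h.const_sub (2 * q))).div_const 6
      |>.const_add k).congr_deriv ?_
    push_cast
    ring
  refine ⟨?_, ?_, hz⟩
  · refine (((h.pow 2).const_sub (q ^ 2)).div_const 2).congr_deriv ?_
    push_cast
    ring
  · refine (h.fun_neg.fun_mul hz).congr_deriv ?_
    ring

/-- For all `0 < c₁ < c₂` there is a solution of the soliton ODE system on `[0, T]`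
with `x(0) = x(T) = 0`, `x ≥ 0`, `z(0) = z₀ > 0`, `y(0) = c₁` and `y(T) = −c₂`. -/
theorem soliton_ODE_existence_slopes (c₁ c₂ : ℝ) (hc₁ : 0 < c₁) (hc : c₁ < c₂) :
    ∃ (T z₀ : ℝ) (x y z : ℝ → ℝ), 0 < T ∧ 0 < z₀ ∧
      IsSolitonODESolution x y z (Set.Icc 0 T) ∧
      x 0 = 0 ∧ x T = 0 ∧ (∀ t ∈ Set.Icc 0 T, 0 ≤ x t) ∧
      z 0 = z₀ ∧ y 0 = c₁ ∧ y T = -c₂ := by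
  obtain ⟨q, hq, hq4⟩ : ∃ q : ℝ, 0 < q ∧ q ^ 4 = 3 * (c₂ - c₁) / 2 := by
    have h : 0 < 3 * (c₂ - c₁) / 2 := by linarith
    refine ⟨√√(3 * (c₂ - c₁) / 2), by positivity, ?_⟩
    rw [show (4 : ℕ) = 2 * 2 from rfl, pow_mul, Real.sq_sqrt (Real.sqrt_nonneg _),
      Real.sq_sqrt h.le]
  set Z : ℝ → ℝ := fun r => c₁ / q + (r + q) ^ 2 * (2 * q - r) / 6 with hZ
  have hclamp : ∀ r, max (-q) (min q r) ∈ Set.Icc (-q) q := fun r =>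
    ⟨le_max_left _ _, max_le (by linarith) (min_le_left _ _)⟩
  have hlow : ∀ r ∈ Set.Icc (-q) q, c₁ / q ≤ Z r := fun r hr => by
    have : 0 ≤ 2 * q - r := by linarith [hr.2]
    simp only [hZ]
    linarith [mul_nonneg (sq_nonneg (r + q)) this]
  have hupp : ∀ r ∈ Set.Icc (-q) q, Z r ≤ c₁ / q + (2 * q) ^ 2 * (3 * q) / 6 := fun r hr => by
    have h₁ : 0 ≤ r + q := by linarith [hr.1]
    have h₂ : r + q ≤ 2 * q := by linarith [hr.2]
    have h₃ : 2 * q - r ≤ 3 * q := by linarith [hr.1]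
    have h₄ : 0 ≤ 2 * q - r := by linarith [hr.2]
    simp only [hZ]
    gcongr
  obtain ⟨r, hr0, hmono, hsurj, hr⟩ := exists_autonomous_solution
    (F := fun r => Z (max (-q) (min q r))) (by fun_prop) (div_pos hc₁ hq)
    (fun r => hlow _ (hclamp r)) (fun r => hupp _ (hclamp r)) (-q)
  obtain ⟨T, hT⟩ := hsurj q
  have hTpos : 0 < T := hmono.lt_iff_lt.1 (by rw [hr0, hT]; linarith)
  have hmem : ∀ t ∈ Set.Icc 0 T, r t ∈ Set.Icc (-q) q := fun t ht =>
    ⟨hr0 ▸ hmono.monotone ht.1, hT ▸ hmono.monotone ht.2⟩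
  have hsol := isSolitonODESolution_of_cubic (r := r) (q := q) (k := c₁ / q) (I := Set.Icc 0 T)
    fun t ht => by
      have := hr t
      simp only [min_eq_right (hmem t ht).2, max_eq_right (hmem t ht).1] at this
      exact this
  refine ⟨T, c₁ / q, _, _, _, hTpos, div_pos hc₁ hq, hsol, ?_, ?_, fun t ht => ?_, ?_, ?_, ?_⟩
  · simp [hr0]
  · simp [hT]
  · have h := hmem t ht
    have := mul_nonneg (sub_nonneg.2 h.2) (neg_le_iff_add_nonneg.1 h.1)
    linarith
  · simp [hr0]
  · simp only [hr0]
    field_simp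
    ring
  · simp only [hT]
    field_simp
    linarith
end

section
/- Let (x, y, z) be a solution of the soliton ODE system on [0, T] with x, y, z continuous. Then for every t ∈ [0, T] one has y(t) − x(t)²/2 = y(0) − x(0)²/2 − ∫₀ᵗ z(s)² ds; in particular the function t ↦ y(t) − x(t)²/2 is nonincreasing on [0, T]. -/
/-- Along a solution, `y − x²/2` has derivative `−z²`. -/
theorem IsSolitonODESolution.hasDerivAt_sub_sq_div_two {x y z : ℝ → ℝ} {I : Set ℝ}
    (hsol : IsSolitonODESolution x y z I) {t : ℝ} (ht : t ∈ I) :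
    HasDerivAt (fun s => y s - (x s) ^ 2 / 2) (-(z t) ^ 2) t := by
  obtain ⟨hx, hy, -⟩ := hsol t ht
  refine (hy.sub ((hx.pow 2).div_const 2)).congr_deriv ?_
  norm_num
  ring

/-- Along a continuous solution of the soliton ODE system the quantity
`y − x²/2` satisfies `y(t) − x(t)²/2 = y(0) − x(0)²/2 − ∫₀ᵗ z²`; in particular
it is nonincreasing. -/
theorem soliton_ODE_monotone_quantity (T : ℝ) (hT : 0 < T) (x y z : ℝ → ℝ)
    (hsol : IsSolitonODESolution x y z (Set.Icc 0 T))
    (hx : ContinuousOn x (Set.Icc 0 T)) (hy : ContinuousOn y (Set.Icc 0 T))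
    (hz : ContinuousOn z (Set.Icc 0 T)) :
    (∀ t ∈ Set.Icc 0 T,
      y t - (x t) ^ 2 / 2 = y 0 - (x 0) ^ 2 / 2 - ∫ s in (0:ℝ)..t, (z s) ^ 2) ∧
    AntitoneOn (fun t => y t - (x t) ^ 2 / 2) (Set.Icc 0 T) := by
  have hderiv := fun t (ht : t ∈ Set.Icc 0 T) => hsol.hasDerivAt_sub_sq_div_two ht
  constructor
  · intro t ht
    have hsub : Set.uIcc 0 t ⊆ Set.Icc 0 T := by
      rw [Set.uIcc_of_le ht.1]
      exact Set.Icc_subset_Icc_right ht.2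
    have hint := intervalIntegral.integral_eq_sub_of_hasDerivAt
      (fun s hs => hderiv s (hsub hs)) ((hz.mono hsub).pow 2).neg.intervalIntegrable
    rw [intervalIntegral.integral_neg] at hint
    linarith
  · refine antitoneOn_of_hasDerivWithinAt_nonpos (f' := fun t => -(z t) ^ 2) (convex_Icc 0 T)
      (fun t ht => (hderiv t ht).continuousAt.continuousWithinAt)
      (fun t ht => (hderiv t (interior_subset ht)).hasDerivWithinAt)
      (fun t _ => neg_nonpos.mpr (sq_nonneg (z t)))
end

section
/- Let (x, y, z) be a solution of the soliton ODE system on an interval [t₂, t₃] such that y(t₂) = 0 and x(t₃) = 0. Then y(t₃) ≤ −x(t₂)²/2. -/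
/-- Along a solution, `y − x²/2` has derivative `−z²`, so it is antitone. -/
theorem IsSolitonODESolution.antitoneOn_sub_sq_div_two {x y z : ℝ → ℝ} {D : Set ℝ}
    (hD : Convex ℝ D) (h : IsSolitonODESolution x y z D) :
    AntitoneOn (fun t => y t - x t ^ 2 / 2) D := by
  have hderiv : ∀ t ∈ D, HasDerivAt (fun t => y t - x t ^ 2 / 2) (-(z t) ^ 2) t := by
    intro t ht
    obtain ⟨hx, hy, -⟩ := h t ht
    refine (hy.sub ((hx.pow 2).div_const 2)).congr_deriv ?_
    push_cast
    ring
  refine antitoneOn_of_hasDerivWithinAt_nonpos (f' := fun t => -(z t) ^ 2) hD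
    (fun t ht => (hderiv t ht).continuousAt.continuousWithinAt)
    (fun t ht => (hderiv t (interior_subset ht)).hasDerivWithinAt) fun t _ => ?_
  exact neg_nonpos.mpr (sq_nonneg _)

/-- If a solution of the soliton ODE system on `[t₂, t₃]` has `y(t₂) = 0` and
`x(t₃) = 0`, then `y(t₃) ≤ −x(t₂)²/2`. -/
theorem soliton_ODE_decay_phase (t₂ t₃ : ℝ) (ht : t₂ ≤ t₃) (x y z : ℝ → ℝ)
    (hsol : IsSolitonODESolution x y z (Set.Icc t₂ t₃))
    (hy₂ : y t₂ = 0) (hx₃ : x t₃ = 0) :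
    y t₃ ≤ -(x t₂) ^ 2 / 2 := by
  have h := hsol.antitoneOn_sub_sq_div_two (convex_Icc t₂ t₃) (Set.left_mem_Icc.mpr ht)
    (Set.right_mem_Icc.mpr ht) ht
  simp only [hy₂, hx₃] at h
  linarith
end

section
/- Let (x, y, z) be a solution of the soliton ODE system on [0, T] with z(0) = z₀ > 0 and x(t) ≥ 0 for all t ∈ [0, T]. Then for every t ∈ [0, T] one has y(t) ≤ z(t) · (y(0)/z₀ − z₀ t); in particular, if y(0) > 0 then y(t) ≤ 0 for every t ∈ [0, T] with t ≥ y(0)/z₀². -/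
/-- Along a solution with `x ≥ 0` on `[0, T]`, the component `z` stays above its positive
initial value. -/
theorem IsSolitonODESolution.le_z {T : ℝ} {x y z : ℝ → ℝ}
    (hsol : IsSolitonODESolution x y z (Set.Icc 0 T)) (hz : 0 < z 0)
    (hx : ∀ t ∈ Set.Icc 0 T, 0 ≤ x t) {t : ℝ} (ht : t ∈ Set.Icc 0 T) : z 0 ≤ z t := by
  have hsq : MonotoneOn (fun s => z s ^ 2) (Set.Icc 0 T) :=
    monotoneOn_of_hasDerivWithinAt_nonneg (convex_Icc 0 T)
      (fun s hs => ((hsol s hs).2.2.pow 2).continuousAt.continuousWithinAt)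
      (fun s hs => ((hsol s (interior_subset hs)).2.2.pow 2).hasDerivWithinAt)
      (fun s hs => by
        have := mul_nonneg (hx s (interior_subset hs)) (sq_nonneg (z s))
        norm_num
        linarith)
  have hle : ∀ s ∈ Set.Icc 0 T, z 0 ^ 2 ≤ z s ^ 2 := fun s hs =>
    hsq ⟨le_rfl, hs.1.trans hs.2⟩ hs hs.1
  have hpos : 0 < z t := by
    by_contra! hneg
    have hcont : ContinuousOn z (Set.Icc 0 t) := fun s hs =>
      (hsol s ⟨hs.1, hs.2.trans ht.2⟩).2.2.continuousAt.continuousWithinAt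
    obtain ⟨s, hs, hs0⟩ := intermediate_value_Icc' ht.1 hcont ⟨hneg, hz.le⟩
    have := hle s ⟨hs.1, hs.2.trans ht.2⟩
    rw [hs0] at this
    nlinarith
  exact (sq_le_sq₀ hz.le hpos.le).mp (hle t ht)

/-- Along a solution of the soliton ODE system with `z(0) = z₀ > 0` and `x ≥ 0`,
one has `y(t) ≤ z(t)·(y(0)/z₀ − z₀ t)`; in particular if `y(0) > 0` then
`y(t) ≤ 0` for all `t ≥ y(0)/z₀²` in `[0, T]`. -/
theorem soliton_ODE_control_phase (T z₀ : ℝ) (hT : 0 < T) (x y z : ℝ → ℝ)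
    (hsol : IsSolitonODESolution x y z (Set.Icc 0 T))
    (hz0 : z 0 = z₀) (hz₀ : 0 < z₀)
    (hx : ∀ t ∈ Set.Icc 0 T, 0 ≤ x t) :
    (∀ t ∈ Set.Icc 0 T, y t ≤ z t * (y 0 / z₀ - z₀ * t)) ∧
    (0 < y 0 → ∀ t ∈ Set.Icc 0 T, y 0 / z₀ ^ 2 ≤ t → y t ≤ 0) := by
  subst hz0
  have hpos : ∀ t ∈ Set.Icc 0 T, 0 < z t := fun t ht => hz₀.trans_le (hsol.le_z hz₀ hx ht)
  have hder : ∀ t ∈ Set.Icc 0 T, HasDerivAt (fun s => y s / z s + z 0 * s) (z 0 - z t) t := by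
    intro t ht
    obtain ⟨-, hy, hz⟩ := hsol t ht
    have hne := (hpos t ht).ne'
    refine ((hy.div hz hne).add ((hasDerivAt_id t).const_mul (z 0))).congr_deriv ?_
    field_simp
    ring
  have hanti : AntitoneOn (fun s => y s / z s + z 0 * s) (Set.Icc 0 T) :=
    antitoneOn_of_hasDerivWithinAt_nonpos (convex_Icc 0 T)
      (fun s hs => (hder s hs).continuousAt.continuousWithinAt)
      (fun s hs => (hder s (interior_subset hs)).hasDerivWithinAt)
      (fun s hs => sub_nonpos.mpr (hsol.le_z hz₀ hx (interior_subset hs)))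
  have hbound : ∀ t ∈ Set.Icc 0 T, y t ≤ z t * (y 0 / z 0 - z 0 * t) := by
    intro t ht
    have h : y t / z t + z 0 * t ≤ y 0 / z 0 + z 0 * 0 := hanti ⟨le_rfl, hT.le⟩ ht ht.1
    rw [← div_le_iff₀' (hpos t ht)]
    linarith
  refine ⟨hbound, fun _ t ht hle => (hbound t ht).trans ?_⟩
  refine mul_nonpos_of_nonneg_of_nonpos (hpos t ht).le (sub_nonpos.mpr ?_)
  rw [div_le_iff₀ (by positivity)] at hle ⊢
  linarith
end

section
/- Let c > 0 and let (x, y, z) be a solution of the soliton ODE system on an interval [t₀, t₁] with x(t) ≥ 0 for all t ∈ [t₀, t₁], y(t₀) ≤ 0, and z(t₀) ≥ c. Then for every t ∈ [t₀, t₁]: y(t) ≤ y(t₀) − c²·(t − t₀) and x(t) ≤ x(t₀) + y(t₀)·(t − t₀) − (c²/2)·(t − t₀)². -/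
/-- If a solution of the soliton ODE system on `[t₀, t₁]` has `x ≥ 0`,
`y(t₀) ≤ 0` and `z(t₀) ≥ c > 0`, then `y(t) ≤ y(t₀) − c²(t − t₀)` and
`x(t) ≤ x(t₀) + y(t₀)(t − t₀) − (c²/2)(t − t₀)²`. -/
theorem soliton_ODE_decay_estimates (c t₀ t₁ : ℝ) (hc : 0 < c) (ht : t₀ ≤ t₁)
    (x y z : ℝ → ℝ)
    (hsol : IsSolitonODESolution x y z (Set.Icc t₀ t₁))
    (hx : ∀ t ∈ Set.Icc t₀ t₁, 0 ≤ x t)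
    (hy₀ : y t₀ ≤ 0) (hz₀ : c ≤ z t₀) :
    ∀ t ∈ Set.Icc t₀ t₁,
      y t ≤ y t₀ - c ^ 2 * (t - t₀) ∧
      x t ≤ x t₀ + y t₀ * (t - t₀) - c ^ 2 / 2 * (t - t₀) ^ 2 := by
  have hcont : ∀ {f g : ℝ → ℝ}, (∀ t ∈ Set.Icc t₀ t₁, HasDerivAt f (g t) t) →
      ContinuousOn f (Set.Icc t₀ t₁) :=
    fun h t hm => (h t hm).continuousAt.continuousWithinAt
  have hsub : ∀ {t}, t ∈ Set.Ico t₀ t₁ → t ∈ Set.Icc t₀ t₁ := fun h => Set.Ico_subset_Icc_self h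
  have hdx : ∀ t ∈ Set.Icc t₀ t₁, HasDerivAt x (y t) t := fun t h => (hsol t h).1
  have hdy : ∀ t ∈ Set.Icc t₀ t₁, HasDerivAt y (x t * y t - (z t) ^ 2) t :=
    fun t h => (hsol t h).2.1
  -- `z ^ 2` is nondecreasing, since its derivative is `2 x z ^ 2`.
  have hdz : ∀ t ∈ Set.Icc t₀ t₁,
      HasDerivAt (fun s => (z s) ^ 2) (2 * (x t * (z t) ^ 2)) t := fun t h => by
    refine ((hsol t h).2.2.pow 2).congr_deriv ?_
    push_cast
    ring
  have hz : ∀ t ∈ Set.Icc t₀ t₁, c ^ 2 ≤ (z t) ^ 2 :=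
    image_le_of_deriv_right_le_deriv_boundary (f' := fun _ => 0) continuousOn_const
      (fun t _ => hasDerivWithinAt_const _ _ _) (pow_le_pow_left₀ hc.le hz₀ 2) (hcont hdz)
      (fun t h => (hdz t (hsub h)).hasDerivWithinAt)
      (fun t h => mul_nonneg two_pos.le (mul_nonneg (hx t (hsub h)) (sq_nonneg _)))
  have hy : ∀ t ∈ Set.Icc t₀ t₁, y t ≤ 0 :=
    image_le_of_deriv_right_lt_deriv_boundary (B := fun _ => 0) (B' := fun _ => 0)
      (hcont hdy) (fun t h => (hdy t (hsub h)).hasDerivWithinAt) hy₀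
      (fun t => hasDerivAt_const _ _)
      (fun t h h0 => by
        have := hz t (hsub h)
        rw [h0]
        nlinarith [pow_pos hc 2])
  have hdB : ∀ t, HasDerivAt (fun s => y t₀ - c ^ 2 * (s - t₀)) (-c ^ 2) t := fun t => by
    refine ((((hasDerivAt_id t).sub_const t₀).const_mul (c ^ 2)).const_sub (y t₀)).congr_deriv ?_
    ring
  have hyB : ∀ t ∈ Set.Icc t₀ t₁, y t ≤ y t₀ - c ^ 2 * (t - t₀) :=
    image_le_of_deriv_right_le_deriv_boundary
      (hcont hdy) (fun t h => (hdy t (hsub h)).hasDerivWithinAt) (by simp)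
      (hcont fun t _ => hdB t) (fun t _ => (hdB t).hasDerivWithinAt)
      (fun t h => by
        nlinarith [hz t (hsub h), mul_nonneg (hx t (hsub h)) (neg_nonneg.2 (hy t (hsub h)))])
  have hdC : ∀ t, HasDerivAt (fun s => x t₀ + y t₀ * (s - t₀) - c ^ 2 / 2 * (s - t₀) ^ 2)
      (y t₀ - c ^ 2 * (t - t₀)) t := fun t => by
    have h := (hasDerivAt_id t).sub_const t₀
    refine (((h.const_mul (y t₀)).const_add (x t₀)).sub
      ((h.pow 2).const_mul (c ^ 2 / 2))).congr_deriv ?_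
    simp
    ring
  have hxC : ∀ t ∈ Set.Icc t₀ t₁,
      x t ≤ x t₀ + y t₀ * (t - t₀) - c ^ 2 / 2 * (t - t₀) ^ 2 :=
    image_le_of_deriv_right_le_deriv_boundary
      (hcont hdx) (fun t h => (hdx t (hsub h)).hasDerivWithinAt) (by simp)
      (hcont fun t _ => hdC t) (fun t _ => (hdC t).hasDerivWithinAt)
      (fun t h => hyB t (hsub h))
  exact fun t h => ⟨hyB t h, hxC t h⟩
end

section
/- For every Λ ≥ 1 there exist δ ∈ (0, 1) and ζ > 0 with the following property: for every z₀ ∈ (0, ζ) and every solution (x, y, z) of the soliton ODE system on [0, S] with x(0) = 0, y(0) = 1, z(0) = z₀ and x(t) ≤ Λ for all t ∈ [0, S], one has z(t) ≤ δ and y(t) ≥ 1/2 for all t ∈ [0, S], and moreover S ≤ 2Λ + 2. Consequently, any such solution that is defined on all of [0, 2Λ + 2] attains x(t₁) ≥ Λ at some time t₁ ≤ 2Λ + 2. -/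
/-- A function with nonnegative derivative on `[0, S]` is bounded below by its initial value. -/
theorem le_of_hasDerivAt_nonneg_on_Icc {f f' : ℝ → ℝ} {S : ℝ}
    (hf : ∀ t ∈ Set.Icc 0 S, HasDerivAt f (f' t) t) (hf' : ∀ t ∈ Set.Icc 0 S, 0 ≤ f' t)
    {t : ℝ} (ht : t ∈ Set.Icc 0 S) : f 0 ≤ f t := by
  refine monotoneOn_of_deriv_nonneg (convex_Icc 0 S)
    (fun s hs => (hf s hs).continuousAt.continuousWithinAt)
    (fun s hs => (hf s (interior_subset hs)).differentiableAt.differentiableWithinAt)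
    (fun s hs => ?_) (Set.left_mem_Icc.2 (ht.1.trans ht.2)) ht ht.1
  rw [(hf s (interior_subset hs)).deriv]
  exact hf' s (interior_subset hs)

/-- A continuous function on `[0, S]` has a primitive there with two-sided derivatives,
vanishing at `0`. -/
theorem ContinuousOn.exists_primitive_Icc {x : ℝ → ℝ} {S : ℝ} (hS : 0 ≤ S)
    (hx : ContinuousOn x (Set.Icc 0 S)) :
    ∃ X : ℝ → ℝ, X 0 = 0 ∧ ∀ t ∈ Set.Icc 0 S, HasDerivAt X (x t) t := by
  have hc : Continuous (Set.IccExtend hS ((Set.Icc 0 S).domRestrict x)) :=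
    (continuousOn_iff_continuous_domRestrict.1 hx).Icc_extend'
  refine ⟨fun t => ∫ s in (0:ℝ)..t, Set.IccExtend hS ((Set.Icc 0 S).domRestrict x) s,
    by simp, fun t ht => ?_⟩
  have h := hc.integral_hasStrictDerivAt 0 t
  rw [Set.IccExtend_of_mem hS _ ht] at h
  exact h.hasDerivAt

/-- If `x ≤ Λ` on `[0, S]` with `S ≤ T` and `z₀` is small compared with `exp (-Λ T) / T`,
then `z` stays small, `y` stays bounded below, and `x` grows at least at speed `1 / 2`. -/
theorem IsSolitonODESolution.growth_bounds {x y z : ℝ → ℝ} {Λ S T z₀ : ℝ}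
    (h : IsSolitonODESolution x y z (Set.Icc 0 S)) (hΛ : 0 ≤ Λ) (hS : 0 ≤ S) (hST : S ≤ T)
    (hT : 1 ≤ T) (hz₀ : 0 < z₀) (hsmall : z₀ * (Real.exp (Λ * T) * T) ≤ 1 / 2)
    (hx0 : x 0 = 0) (hy0 : y 0 = 1) (hz0 : z 0 = z₀) (hxΛ : ∀ t ∈ Set.Icc 0 S, x t ≤ Λ) :
    (∀ t ∈ Set.Icc 0 S, z t ≤ 1 / 2 ∧ 1 / 2 ≤ y t) ∧ S ≤ 2 * Λ := by
  obtain ⟨X, hX0, hX⟩ := ContinuousOn.exists_primitive_Icc hS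
    (fun t ht => (h t ht).1.continuousAt.continuousWithinAt : ContinuousOn x (Set.Icc 0 S))
  have hE : ∀ t ∈ Set.Icc 0 S,
      HasDerivAt (fun s => Real.exp (-X s)) (Real.exp (-X t) * -x t) t :=
    fun t ht => (hX t ht).neg.exp
  set M := Real.exp (Λ * T) with hM
  have hM1 : 1 ≤ M := Real.one_le_exp (by positivity)
  have hXle : ∀ t ∈ Set.Icc 0 S, Real.exp (X t) ≤ M := by
    intro t ht
    have h1 := le_of_hasDerivAt_nonneg_on_Icc
      (fun s hs => ((hasDerivAt_id s).const_mul Λ).sub (hX s hs))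
      (fun s hs => by have := hxΛ s hs; linarith) ht
    simp only [Pi.sub_apply, id, hX0] at h1
    have h2 : Λ * t ≤ Λ * T := mul_le_mul_of_nonneg_left (ht.2.trans hST) hΛ
    exact Real.exp_le_exp.2 (by linarith)
  have hzeq : ∀ t ∈ Set.Icc 0 S, z t * Real.exp (-X t) = z₀ := by
    intro t ht
    have hd : ∀ s ∈ Set.Icc 0 S, HasDerivAt (fun s => z s * Real.exp (-X s)) 0 s := by
      intro s hs
      have := (h s hs).2.2.mul (hE s hs)
      exact this.congr_deriv (by ring)
    have h1 := le_of_hasDerivAt_nonneg_on_Icc hd (fun _ _ => le_rfl) ht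
    have h2 := le_of_hasDerivAt_nonneg_on_Icc (fun s hs => (hd s hs).neg)
      (fun _ _ => by simp) ht
    simp only [Pi.neg_apply, hX0, hz0, neg_zero, Real.exp_zero, mul_one] at h1 h2
    linarith
  have hcancel : ∀ t, Real.exp (-X t) * Real.exp (X t) = 1 := fun t => by
    rw [← Real.exp_add]; simp
  have hz : ∀ t ∈ Set.Icc 0 S, z t = z₀ * Real.exp (X t) := by
    intro t ht
    rw [← hzeq t ht, mul_assoc, hcancel, mul_one]
  have hzM : z₀ * M ≤ 1 / 2 :=
    (mul_le_mul_of_nonneg_left (le_mul_of_one_le_right (by positivity) hT) hz₀.le).trans hsmall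
  have hz₀1 : z₀ ≤ 1 := by nlinarith
  have hyE : ∀ t ∈ Set.Icc 0 S, 1 / 2 ≤ y t * Real.exp (-X t) := by
    intro t ht
    have h1 := le_of_hasDerivAt_nonneg_on_Icc
      (fun s hs => ((h s hs).2.1.mul (hE s hs)).add ((hasDerivAt_id s).const_mul (z₀ ^ 2 * M)))
      (fun s hs => by
        have e : z s ^ 2 * Real.exp (-X s) = z₀ ^ 2 * Real.exp (X s) := by
          rw [sq, mul_assoc, hzeq s hs, hz s hs]; ring
        have := mul_le_mul_of_nonneg_left (hXle s hs) (sq_nonneg z₀)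
        linarith) ht
    simp only [Pi.add_apply, Pi.mul_apply, id, hX0, hy0, neg_zero, Real.exp_zero] at h1
    have h2 : z₀ ^ 2 * M * t ≤ z₀ * (M * T) := by
      have h3 : z₀ ^ 2 * M * t ≤ z₀ ^ 2 * M * T :=
        mul_le_mul_of_nonneg_left (ht.2.trans hST) (by positivity)
      have h4 : z₀ * (z₀ * (M * T)) ≤ 1 * (z₀ * (M * T)) :=
        mul_le_mul_of_nonneg_right hz₀1 (by positivity)
      linarith
    linarith
  have hyX : ∀ t ∈ Set.Icc 0 S, 1 / 2 * Real.exp (X t) ≤ y t := by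
    intro t ht
    have h1 := mul_le_mul_of_nonneg_right (hyE t ht) (Real.exp_pos (X t)).le
    rwa [mul_assoc (y t), hcancel, mul_one] at h1
  have hx : ∀ t ∈ Set.Icc 0 S, 0 ≤ x t := by
    intro t ht
    rw [← hx0]
    exact le_of_hasDerivAt_nonneg_on_Icc (fun s hs => (h s hs).1)
      (fun s hs => (by positivity : 0 ≤ 1 / 2 * Real.exp (X s)).trans (hyX s hs)) ht
  have hy : ∀ t ∈ Set.Icc 0 S, 1 / 2 ≤ y t := by
    intro t ht
    have h1 := le_of_hasDerivAt_nonneg_on_Icc hX hx ht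
    have h2 : 1 ≤ Real.exp (X t) := Real.one_le_exp (hX0 ▸ h1)
    linarith [hyX t ht]
  refine ⟨fun t ht => ⟨?_, hy t ht⟩, ?_⟩
  · rw [hz t ht]
    exact (mul_le_mul_of_nonneg_left (hXle t ht) hz₀.le).trans hzM
  · have hSS : S ∈ Set.Icc 0 S := Set.right_mem_Icc.2 hS
    have h1 := le_of_hasDerivAt_nonneg_on_Icc
      (fun s hs => (h s hs).1.sub ((hasDerivAt_id s).const_mul (1 / 2)))
      (fun s hs => by have := hy s hs; linarith) hSS
    simp only [Pi.sub_apply, id, hx0] at h1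
    linarith [hxΛ S hSS]

/-- Growth phase: for every `Λ ≥ 1` there are `δ ∈ (0,1)` and `ζ > 0` such that
any solution starting at `(0, 1, z₀)` with `z₀ ∈ (0, ζ)` and `x ≤ Λ` on `[0, S]`
satisfies `z ≤ δ`, `y ≥ 1/2` on `[0, S]` and `S ≤ 2Λ + 2`; consequently any such
solution defined on all of `[0, 2Λ + 2]` attains `x(t₁) ≥ Λ` somewhere. -/
theorem soliton_ODE_growth_phase (Λ : ℝ) (hΛ : 1 ≤ Λ) :
    ∃ δ : ℝ, 0 < δ ∧ δ < 1 ∧ ∃ ζ : ℝ, 0 < ζ ∧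
      (∀ z₀ ∈ Set.Ioo (0:ℝ) ζ, ∀ S : ℝ, 0 ≤ S → ∀ x y z : ℝ → ℝ,
        IsSolitonODESolution x y z (Set.Icc 0 S) →
        x 0 = 0 → y 0 = 1 → z 0 = z₀ →
        (∀ t ∈ Set.Icc 0 S, x t ≤ Λ) →
        ((∀ t ∈ Set.Icc 0 S, z t ≤ δ ∧ 1 / 2 ≤ y t) ∧ S ≤ 2 * Λ + 2)) ∧
      (∀ z₀ ∈ Set.Ioo (0:ℝ) ζ, ∀ x y z : ℝ → ℝ,
        IsSolitonODESolution x y z (Set.Icc 0 (2 * Λ + 2)) →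
        x 0 = 0 → y 0 = 1 → z 0 = z₀ →
        ∃ t₁ ∈ Set.Icc (0:ℝ) (2 * Λ + 2), Λ ≤ x t₁) := by
  set T := 2 * Λ + 2 with hT
  have hT1 : 1 ≤ T := by linarith
  have hC : 0 < Real.exp (Λ * T) * T := by positivity
  have hsmall : ∀ z₀ ∈ Set.Ioo (0:ℝ) (1 / 2 / (Real.exp (Λ * T) * T)),
      z₀ * (Real.exp (Λ * T) * T) ≤ 1 / 2 := fun z₀ hz₀ => ((lt_div_iff₀ hC).1 hz₀.2).le
  refine ⟨1 / 2, by norm_num, by norm_num, 1 / 2 / (Real.exp (Λ * T) * T), by positivity,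
    fun z₀ hz₀ S hS x y z h hx0 hy0 hz0 hxΛ => ?_, fun z₀ hz₀ x y z h hx0 hy0 hz0 => ?_⟩
  · have hsub : Set.Icc 0 (min S T) ⊆ Set.Icc 0 S :=
      Set.Icc_subset_Icc_right (min_le_left S T)
    have hmin := (IsSolitonODESolution.growth_bounds (fun t ht => h t (hsub ht)) (by linarith)
      (le_min hS (by linarith)) (min_le_right S T) hT1 hz₀.1 (hsmall z₀ hz₀) hx0 hy0 hz0
      (fun t ht => hxΛ t (hsub ht))).2
    have hST : S ≤ T := by
      rcases min_le_iff.1 hmin with h1 | h1 <;> linarith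
    exact ⟨(h.growth_bounds (by linarith) hS hST hT1 hz₀.1 (hsmall z₀ hz₀) hx0 hy0 hz0 hxΛ).1,
      hST⟩
  · by_contra! hlt
    have := (h.growth_bounds (by linarith) (by linarith) le_rfl hT1 hz₀.1 (hsmall z₀ hz₀)
      hx0 hy0 hz0 (fun t ht => (hlt t ht).le)).2
    linarith
end

section
/- For every ε > 0 there exists Z > 0 such that for every z₀ ≥ Z there exist T > 0 and a solution (x, y, z) of the soliton ODE system on [0, T] with x(0) = 0, y(0) = 1, z(0) = z₀, x(t) > 0 for all t ∈ (0, T), x(T) = 0, and |y(T) + 1| < ε. (Thus for large initial bundle curvature the ratio y(0)/|y(T)| tends to 1.) -/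
open Set Metric

/-- **Picard-Lindelöf theorem**, differential form, recording that the solution stays in the
closed ball on which the vector field is controlled. -/
theorem IsPicardLindelof.exists_hasDerivWithinAt_mem_closedBall {E : Type*}
    [NormedAddCommGroup E] [NormedSpace ℝ E] [CompleteSpace E] {f : ℝ → E → E}
    {tmin tmax : ℝ} {t₀ : Icc tmin tmax} {x₀ : E} {a L K : NNReal}
    (hf : IsPicardLindelof f t₀ x₀ a 0 L K) :
    ∃ α : ℝ → E, α t₀ = x₀ ∧ (∀ t, α t ∈ closedBall x₀ a) ∧
      ∀ t ∈ Icc tmin tmax, HasDerivWithinAt α (f t (α t)) (Icc tmin tmax) t := by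
  have hx : x₀ ∈ closedBall x₀ ((0 : NNReal) : ℝ) := mem_closedBall_self le_rfl
  obtain ⟨α, hα⟩ := ODE.FunSpace.exists_isFixedPt_next hf hx
  refine ⟨α.compProj, by rw [ODE.FunSpace.compProj_val, ← hα, ODE.FunSpace.next_apply₀],
    fun _ ↦ α.compProj_mem_closedBall hf.mul_max_le, fun t ht ↦ ?_⟩
  apply ODE.hasDerivWithinAt_picard_Icc t₀.2 hf.continuousOn_uncurry
    α.continuous_compProj.continuousOn (fun _ _ ↦ α.compProj_mem_closedBall hf.mul_max_le)
    x₀ ht |>.congr_of_mem _ ht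
  intro t' ht'
  nth_rw 1 [← hα]
  rw [ODE.FunSpace.compProj_of_mem ht', ODE.FunSpace.next_apply]

/-- A jointly `C¹` vector field bounded by `L` on a closed ball of radius `a` has an integral
curve in that ball on any time interval whose length on either side of `t₀` is at most `a / L`. -/
theorem ContDiff.exists_hasDerivWithinAt_mem_closedBall {E : Type*}
    [NormedAddCommGroup E] [NormedSpace ℝ E] [ProperSpace E] {f : ℝ → E → E}
    (hf : ContDiff ℝ 1 (Function.uncurry f)) {tmin tmax : ℝ} (t₀ : Icc tmin tmax) (x₀ : E)
    {a L : NNReal} (hL : ∀ t ∈ Icc tmin tmax, ∀ x ∈ closedBall x₀ a, ‖f t x‖ ≤ L)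
    (hmul : L * max (tmax - t₀) (t₀ - tmin) ≤ a) :
    ∃ α : ℝ → E, α t₀ = x₀ ∧ (∀ t, α t ∈ closedBall x₀ a) ∧
      ∀ t ∈ Icc tmin tmax, HasDerivWithinAt α (f t (α t)) (Icc tmin tmax) t := by
  obtain ⟨K, hK⟩ := (hf.contDiffOn (s := Icc tmin tmax ×ˢ closedBall x₀ a)).exists_lipschitzOnWith
    one_ne_zero ((convex_Icc _ _).prod (convex_closedBall _ _))
    (isCompact_Icc.prod (isCompact_closedBall _ _))
  have hf' := hf.continuous
  refine IsPicardLindelof.exists_hasDerivWithinAt_mem_closedBall (L := L) (K := K)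
    ⟨fun t ht x hx y hy ↦ ?_, fun x _ ↦ ?_, hL, by simpa using hmul⟩
  · simpa [Prod.edist_eq] using hK (mk_mem_prod ht hx) (mk_mem_prod ht hy)
  · exact (hf'.comp (Continuous.prodMk_left x)).continuousOn

/-- The deviation of the rescaled soliton system from its explicit limit
`(s - s² / 2, 1 - s, 1)`, with its components scaled by `1`, `η`, `η²`, stays bounded. -/
theorem exists_scaled_deviation {η b : ℝ} (hη : 0 < η) (hη' : η ≤ 1 / 33) (hb : 0 ≤ b)
    (hb' : b ≤ 1) :
    ∃ u v w : ℝ → ℝ, u 0 = 0 ∧ v 0 = 0 ∧ w 0 = 0 ∧ ∀ t ∈ Ioo (-1 : ℝ) 3, |v t| ≤ 1 ∧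
      HasDerivAt u (η * v t) t ∧
      HasDerivAt v (η ^ 2 * b * (t - t ^ 2 / 2 + u t) * (1 - t + η * v t)
        - 2 * η * w t - η ^ 3 * w t ^ 2) t ∧
      HasDerivAt w (η * b * (t - t ^ 2 / 2 + u t) * (1 + η ^ 2 * w t)) t := by
  let f : ℝ → ℝ × ℝ × ℝ → ℝ × ℝ × ℝ := fun t p ↦
    (η * p.2.1, η ^ 2 * b * (t - t ^ 2 / 2 + p.1) * (1 - t + η * p.2.1)
        - 2 * η * p.2.2 - η ^ 3 * p.2.2 ^ 2,
      η * b * (t - t ^ 2 / 2 + p.1) * (1 + η ^ 2 * p.2.2))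
  have hf : ContDiff ℝ 1 (Function.uncurry f) := by
    unfold f Function.uncurry
    fun_prop
  have hbound : ∀ t ∈ Icc (-1 : ℝ) 3, ∀ p ∈ closedBall (0 : ℝ × ℝ × ℝ) ((1 : NNReal) : ℝ),
      ‖f t p‖ ≤ (⟨11 * η, by positivity⟩ : NNReal) := by
    rintro t ⟨ht₁, ht₂⟩ ⟨u, v, w⟩ hp
    simp only [mem_closedBall, dist_zero_right, Prod.norm_def, sup_le_iff, Real.norm_eq_abs,
      NNReal.coe_one] at hp
    obtain ⟨hu, hv, hw⟩ := hp
    have hX : |t - t ^ 2 / 2 + u| ≤ 5 / 2 := by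
      rw [abs_le] at hu ⊢
      constructor <;> nlinarith
    have hηv : |η * v| ≤ η := by
      rw [abs_mul, abs_of_pos hη]
      exact mul_le_of_le_one_right hη.le hv
    have hη2 : η ^ 2 ≤ η := by nlinarith
    have hη3 : η ^ 3 ≤ η := by nlinarith
    have hY : |1 - t + η * v| ≤ 3 := by
      rw [abs_le] at hηv ⊢
      constructor <;> linarith
    have hZ : |1 + η ^ 2 * w| ≤ 2 := by
      rw [abs_le] at hw ⊢
      constructor <;> nlinarith
    simp only [f, Prod.norm_def, sup_le_iff, Real.norm_eq_abs]
    refine ⟨by linarith, ?_, ?_⟩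
    · have h₁ : |η ^ 2 * b * (t - t ^ 2 / 2 + u) * (1 - t + η * v)| ≤ η * 1 * (5 / 2) * 3 := by
        rw [abs_mul, abs_mul, abs_mul, abs_of_nonneg hb, abs_of_nonneg (sq_nonneg η)]
        gcongr
      have h₂ : |2 * η * w| ≤ 2 * η * 1 := by
        rw [abs_mul, abs_of_pos (by positivity : 0 < 2 * η)]
        gcongr
      have h₃ : |η ^ 3 * w ^ 2| ≤ η * 1 ^ 2 := by
        rw [abs_mul, abs_of_pos (by positivity : 0 < η ^ 3), abs_pow]
        gcongr
      rw [abs_le] at *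
      constructor <;> linarith
    · calc |η * b * (t - t ^ 2 / 2 + u) * (1 + η ^ 2 * w)| ≤ η * 1 * (5 / 2) * 2 := by
            rw [abs_mul, abs_mul, abs_mul, abs_of_nonneg hb, abs_of_pos hη]
            gcongr
        _ ≤ 11 * η := by linarith
  obtain ⟨α, hα₀, hα, hα'⟩ := hf.exists_hasDerivWithinAt_mem_closedBall
    ⟨0, by norm_num, by norm_num⟩ 0 hbound (by
      change 11 * η * max (3 - 0) (0 - -1) ≤ 1
      norm_num
      linarith)
  simp only at hα₀
  refine ⟨fun t ↦ (α t).1, fun t ↦ (α t).2.1, fun t ↦ (α t).2.2, by simp [hα₀], by simp [hα₀],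
    by simp [hα₀], fun t ht ↦ ?_⟩
  have hd : HasDerivAt α (f t (α t)) t :=
    (hα' t (Ioo_subset_Icc_self ht)).hasDerivAt (Icc_mem_nhds ht.1 ht.2)
  have hmem := hα t
  simp only [mem_closedBall, dist_zero_right, Prod.norm_def, sup_le_iff, Real.norm_eq_abs,
      NNReal.coe_one] at hmem
  exact ⟨hmem.2.1, hd.fst, hd.snd.fst, hd.snd.snd⟩

/-- For small `κ` the rescaled soliton system has a solution on `(-1, 3)` whose slope stays
uniformly close to `1 - s`. -/
theorem exists_rescaled_solution {η κ : ℝ} (hη : 0 < η) (hη' : η ≤ 1 / 33) (hκ : 0 ≤ κ)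
    (hκ' : κ ≤ η ^ 3) :
    ∃ X Y Z : ℝ → ℝ, X 0 = 0 ∧ Y 0 = 1 ∧ Z 0 = 1 ∧ ∀ s ∈ Ioo (-1 : ℝ) 3,
      |Y s - (1 - s)| ≤ η ∧ HasDerivAt X (Y s) s ∧
      HasDerivAt Y (κ * X s * Y s - Z s ^ 2) s ∧ HasDerivAt Z (κ * X s * Z s) s := by
  obtain ⟨u, v, w, hu, hv, hw, h⟩ := exists_scaled_deviation (b := κ / η ^ 3) hη hη'
    (by positivity) ((div_le_one (by positivity)).2 hκ')
  refine ⟨fun s ↦ s - s ^ 2 / 2 + u s, fun s ↦ 1 - s + η * v s, fun s ↦ 1 + η ^ 2 * w s,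
    by simp [hu], by simp [hv], by simp [hw], fun s hs ↦ ?_⟩
  obtain ⟨hvs, hu', hv', hw'⟩ := h s hs
  refine ⟨?_, ?_, ?_, ?_⟩
  · rw [add_sub_cancel_left, abs_mul, abs_of_pos hη]
    exact mul_le_of_le_one_right hη.le hvs
  · refine (((hasDerivAt_id s).sub (((hasDerivAt_id s).pow 2).div_const 2)).add hu').congr_deriv ?_
    beta_reduce
    simp only [id]
    ring
  · refine (((hasDerivAt_id s).const_sub 1).add (hv'.const_mul η)).congr_deriv ?_
    beta_reduce
    field_simp
    ring
  · refine ((hw'.const_mul (η ^ 2)).const_add 1).congr_deriv ?_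
    beta_reduce
    field_simp

/-- A function starting at `0` with slope close to `1 - s` returns to `0` with slope close
to `-1`. -/
theorem exists_first_return {X Y : ℝ → ℝ} {η : ℝ} (hη : 0 < η) (hη' : η ≤ 1 / 33)
    (hX₀ : X 0 = 0) (hX : ∀ s ∈ Ioo (-1 : ℝ) 3, HasDerivAt X (Y s) s)
    (hY : ∀ s ∈ Ioo (-1 : ℝ) 3, |Y s - (1 - s)| ≤ η) :
    ∃ T ∈ Ioo (0 : ℝ) 3, X T = 0 ∧ (∀ s ∈ Ioo 0 T, 0 < X s) ∧ |Y T + 1| ≤ 5 * η := by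
  have hest : ∀ s ∈ Ioo (0 : ℝ) 3, |X s - (s - s ^ 2 / 2)| ≤ η * s := by
    intro s hs
    have hd : ∀ r ∈ Icc 0 s, HasDerivWithinAt (fun r ↦ X r - (r - r ^ 2 / 2))
        (Y r - (1 - r)) (Icc 0 s) r := by
      intro r hr
      refine HasDerivAt.hasDerivWithinAt ?_
      refine ((hX r ⟨by linarith [hr.1], hr.2.trans_lt hs.2⟩).sub
        ((hasDerivAt_id r).sub (((hasDerivAt_id r).pow 2).div_const 2))).congr_deriv ?_
      simp
    simpa [hX₀] using norm_image_sub_le_of_norm_deriv_le_segment' hd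
      (fun r hr ↦ hY r ⟨by linarith [hr.1], hr.2.trans hs.2⟩) s ⟨hs.1.le, le_rfl⟩
  have hlow : ∀ s ∈ Ioo 0 (2 - 2 * η), 0 < X s := by
    intro s hs
    have := (abs_le.1 (hest s ⟨hs.1, by linarith [hs.2]⟩)).1
    nlinarith [mul_pos hs.1 (sub_pos.2 hs.2)]
  have hhigh : X (2 + 4 * η) < 0 := by
    have := (abs_le.1 (hest (2 + 4 * η) ⟨by linarith, by linarith⟩)).2
    nlinarith
  have hsub : Icc (2 - 4 * η) (2 + 4 * η) ⊆ Ioo (-1) 3 := fun s hs ↦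
    ⟨by linarith [hs.1], by linarith [hs.2]⟩
  have hcont : ContinuousOn X (Icc (2 - 4 * η) (2 + 4 * η)) := fun s hs ↦
    (hX s (hsub hs)).continuousAt.continuousWithinAt
  have hanti : StrictAntiOn X (Icc (2 - 4 * η) (2 + 4 * η)) := by
    refine strictAntiOn_of_deriv_neg (convex_Icc _ _) hcont fun s hs ↦ ?_
    have hs' := interior_subset hs
    rw [(hX s (hsub hs')).deriv]
    linarith [(abs_le.1 (hY s (hsub hs'))).2, hs'.1]
  obtain ⟨T, hT, hXT⟩ := intermediate_value_Icc' (by linarith) hcont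
    ⟨hhigh.le, (hlow (2 - 4 * η) ⟨by linarith, by linarith⟩).le⟩
  refine ⟨T, ⟨by linarith [hT.1], (hsub hT).2⟩, hXT, fun s hs ↦ ?_, ?_⟩
  · rcases lt_or_ge s (2 - 2 * η) with h | h
    · exact hlow s ⟨hs.1, h⟩
    · exact hXT ▸ hanti ⟨by linarith, hs.2.le.trans hT.2⟩ hT hs.2
  · have := abs_le.1 (hY T (hsub hT))
    exact abs_le.2 ⟨by linarith [hT.2], by linarith [hT.1]⟩


/-- For large initial values `z₀` the solution starting at `(0, 1, z₀)` returns
to `x = 0` with terminal slope close to `−1`. -/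
theorem soliton_ODE_large_z₀ (ε : ℝ) (hε : 0 < ε) :
    ∃ Z : ℝ, 0 < Z ∧ ∀ z₀ : ℝ, Z ≤ z₀ →
      ∃ (T : ℝ) (x y z : ℝ → ℝ), 0 < T ∧
        IsSolitonODESolution x y z (Set.Icc 0 T) ∧
        x 0 = 0 ∧ y 0 = 1 ∧ z 0 = z₀ ∧
        (∀ t ∈ Set.Ioo 0 T, 0 < x t) ∧ x T = 0 ∧ |y T + 1| < ε := by
  set η := min (1 / 33) (ε / 6) with hη_def
  have hη : 0 < η := by positivity
  have hη' : η ≤ 1 / 33 := min_le_left _ _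
  have hηε : η ≤ ε / 6 := min_le_right _ _
  refine ⟨1 / η, by positivity, fun z₀ hz₀ ↦ ?_⟩
  have hz : 0 < z₀ := lt_of_lt_of_le (by positivity) hz₀
  have hinv : 1 / z₀ ≤ η := (one_div_le hη hz).1 hz₀
  have hκ' : (1 / z₀) ^ 4 ≤ η ^ 3 :=
    (pow_le_pow_left₀ (by positivity) hinv 4).trans
      (pow_le_pow_of_le_one hη.le (by linarith) (by norm_num))
  obtain ⟨X, Y, Z, hX₀, hY₀, hZ₀, h⟩ :=
    exists_rescaled_solution hη hη' (by positivity) hκ'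
  obtain ⟨T, hT, hXT, hpos, hYT⟩ := exists_first_return hη hη' hX₀
    (fun s hs ↦ (h s hs).2.1) (fun s hs ↦ (h s hs).1)
  have hscale : z₀ ^ 2 * (T / z₀ ^ 2) = T := by field_simp
  refine ⟨T / z₀ ^ 2, fun t ↦ X (z₀ ^ 2 * t) / z₀ ^ 2, fun t ↦ Y (z₀ ^ 2 * t),
    fun t ↦ z₀ * Z (z₀ ^ 2 * t), div_pos hT.1 (by positivity), fun t ht ↦ ?_,
    by simp [hX₀], by simp [hY₀], by simp [hZ₀], fun t ht ↦ ?_, by simp [hscale, hXT], ?_⟩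
  · have hle : z₀ ^ 2 * t ≤ T := by
      rw [← hscale]
      exact mul_le_mul_of_nonneg_left ht.2 (by positivity)
    have hge : 0 ≤ z₀ ^ 2 * t := mul_nonneg (by positivity) ht.1
    obtain ⟨-, hX, hY, hZ⟩ := h (z₀ ^ 2 * t) ⟨by linarith, hle.trans_lt hT.2⟩
    have hs : HasDerivAt (fun t ↦ z₀ ^ 2 * t) (z₀ ^ 2) t := by
      simpa using (hasDerivAt_id t).const_mul (z₀ ^ 2)
    refine ⟨?_, ?_, ?_⟩
    · refine ((hX.comp t hs).div_const (z₀ ^ 2)).congr_deriv ?_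
      beta_reduce
      field_simp
    · refine (hY.comp t hs).congr_deriv ?_
      beta_reduce
      field_simp
    · refine ((hZ.comp t hs).const_mul z₀).congr_deriv ?_
      beta_reduce
      field_simp
  · refine div_pos (hpos _ ⟨mul_pos (by positivity) ht.1, ?_⟩) (by positivity)
    rw [← hscale]
    exact mul_lt_mul_of_pos_left ht.2 (by positivity)
  · simp only [hscale]
    linarith
end

section
/- For every M > 0 there exists ζ > 0 such that for every z₀ ∈ (0, ζ) there exist T > 0 and a solution (x, y, z) of the soliton ODE system on [0, T] with x(0) = 0, y(0) = 1, z(0) = z₀, x(t) > 0 for all t ∈ (0, T), x(T) = 0, and y(T) ≤ −M. (Thus for small initial bundle curvature the terminal slope |y(T)| is arbitrarily large.) -/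
/-- The autonomous scalar equation `G' = f ∘ G` with a continuous, positive and bounded right-hand
side has a global solution through `0`, which is a strictly increasing bijection of `ℝ`. -/
lemma exists_strictMono_surjective_hasDerivAt {f : ℝ → ℝ} {C : ℝ} (hf : Continuous f)
    (hpos : ∀ s, 0 < f s) (hC : ∀ s, f s ≤ C) :
    ∃ G : ℝ → ℝ, StrictMono G ∧ Function.Surjective G ∧ G 0 = 0 ∧
      ∀ t, HasDerivAt G (f (G t)) t := by
  have hC0 : 0 < C := (hpos 0).trans_le (hC 0)
  have hinv : Continuous fun s => (f s)⁻¹ := hf.inv₀ fun s => (hpos s).ne'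
  let F : ℝ → ℝ := fun s => ∫ u in (0 : ℝ)..s, (f u)⁻¹
  have hF0 : F 0 = 0 := intervalIntegral.integral_same
  have hF : ∀ s, HasDerivAt F (f s)⁻¹ s := fun s => hinv.integral_hasStrictDerivAt 0 s |>.hasDerivAt
  have hFc : Continuous F := continuous_iff_continuousAt.2 fun s => (hF s).continuousAt
  have hFm : StrictMono F := strictMono_of_deriv_pos fun s => by
    rw [(hF s).deriv]
    exact inv_pos.2 (hpos s)
  have hD : ∀ s, HasDerivAt (fun s => F s - C⁻¹ * s) ((f s)⁻¹ - C⁻¹) s := fun s => by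
    exact ((hF s).sub ((hasDerivAt_id s).const_mul C⁻¹)).congr_deriv (by rw [mul_one])
  have hDm : Monotone fun s => F s - C⁻¹ * s :=
    monotone_of_deriv_nonneg (fun s => (hD s).differentiableAt) fun s => by
      rw [(hD s).deriv, sub_nonneg]
      exact inv_anti₀ (hpos s) (hC s)
  have hFs : Function.Surjective F := by
    refine hFc.surjective ?_ ?_
    · refine Filter.tendsto_atTop_mono' _ ?_
        (Filter.tendsto_id.const_mul_atTop (inv_pos.2 hC0))
      filter_upwards [Filter.eventually_ge_atTop 0] with s hs
      simpa [hF0] using hDm hs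
    · refine Filter.tendsto_atBot_mono' _ ?_
        (Filter.tendsto_id.const_mul_atBot (inv_pos.2 hC0))
      filter_upwards [Filter.eventually_le_atBot 0] with s hs
      simpa [hF0] using hDm hs
  let e := hFm.orderIsoOfSurjective F hFs
  have hFe : ∀ t, F (e.symm t) = t := e.apply_symm_apply
  refine ⟨e.symm, e.symm.strictMono, e.symm.surjective, ?_, fun t => ?_⟩
  · exact hFm.injective ((hFe 0).trans hF0.symm)
  · simpa using (hF (e.symm t)).of_local_left_inverse e.symm.continuous.continuousAt
      (inv_ne_zero (hpos _).ne') (Filter.Eventually.of_forall hFe)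

/-- In the time variable `τ` with `dτ = z dt` the soliton ODE system becomes linear in
`(x, y / z, z)`, and its solutions are polynomials in `τ`. -/
lemma isSolitonODESolution_comp {G : ℝ → ℝ} {I : Set ℝ} (p z₀ : ℝ)
    (hG : ∀ t ∈ I, HasDerivAt G (z₀ + p * G t ^ 2 / 2 - G t ^ 3 / 6) t) :
    IsSolitonODESolution (fun t => p * G t - G t ^ 2 / 2)
      (fun t => (p - G t) * (z₀ + p * G t ^ 2 / 2 - G t ^ 3 / 6))
      (fun t => z₀ + p * G t ^ 2 / 2 - G t ^ 3 / 6) I := by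
  intro t ht
  have h := hG t ht
  have hz := ((((h.pow 2).const_mul p).div_const 2).const_add z₀).sub ((h.pow 3).div_const 6)
  refine ⟨?_, ?_, ?_⟩
  · refine ((h.const_mul p).sub ((h.pow 2).div_const 2)).congr_deriv ?_
    push_cast
    ring
  · refine ((h.const_sub p).mul hz).congr_deriv ?_
    simp only [Pi.sub_apply, Pi.pow_apply]
    push_cast
    ring
  · refine hz.congr_deriv ?_
    push_cast
    ring

/-- For small initial values `z₀` the solution starting at `(0, 1, z₀)` returns
to `x = 0` with arbitrarily large negative terminal slope. -/
theorem soliton_ODE_small_z₀ (M : ℝ) (hM : 0 < M) :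
    ∃ ζ : ℝ, 0 < ζ ∧ ∀ z₀ ∈ Set.Ioo (0:ℝ) ζ,
      ∃ (T : ℝ) (x y z : ℝ → ℝ), 0 < T ∧
        IsSolitonODESolution x y z (Set.Icc 0 T) ∧
        x 0 = 0 ∧ y 0 = 1 ∧ z 0 = z₀ ∧
        (∀ t ∈ Set.Ioo 0 T, 0 < x t) ∧ x T = 0 ∧ y T ≤ -M := by
  refine ⟨(2 * (M + 1))⁻¹, by positivity, fun z₀ ⟨hz₀, hlt⟩ => ?_⟩
  obtain ⟨p, hp⟩ : ∃ p, p = z₀⁻¹ := ⟨_, rfl⟩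
  have hpz : p * z₀ = 1 := by rw [hp, inv_mul_cancel₀ hz₀.ne']
  have hpM : 2 * (M + 1) < p := by
    rw [hp]
    exact (lt_inv_comm₀ hz₀ (by positivity)).1 hlt
  have hp0 : 0 < p := by linarith
  let c : ℝ → ℝ := fun s => max 0 (min s (2 * p))
  have hc0 : ∀ s, 0 ≤ c s := fun s => le_max_left _ _
  have hc1 : ∀ s, c s ≤ 2 * p := fun s => max_le (by positivity) (min_le_right _ _)
  have hc : ∀ s ∈ Set.Icc 0 (2 * p), c s = s := fun s hs => by
    simp only [c, min_eq_left hs.2, max_eq_right hs.1]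
  obtain ⟨G, hGm, hGs, hG0, hG⟩ := exists_strictMono_surjective_hasDerivAt
    (f := fun s => z₀ + p * c s ^ 2 / 2 - c s ^ 3 / 6) (C := z₀ + p * (2 * p) ^ 2 / 2)
    (by fun_prop)
    (fun s => by
      have := mul_nonneg (sq_nonneg (c s)) (show 0 ≤ 3 * p - c s by linarith [hc1 s])
      nlinarith)
    (fun s => by
      have h3 := pow_nonneg (hc0 s) 3
      have h2 := mul_le_mul_of_nonneg_left (pow_le_pow_left₀ (hc0 s) (hc1 s) 2) hp0.le
      linarith)
  obtain ⟨T, hT⟩ := hGs (2 * p)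
  have hT0 : 0 < T := hGm.lt_iff_lt.1 (by rw [hG0, hT]; positivity)
  refine ⟨T, _, _, _, hT0, isSolitonODESolution_comp (G := G) p z₀ fun t ht => ?_, ?_, ?_, ?_,
    fun t ht => ?_, ?_, ?_⟩
  · have hmem : G t ∈ Set.Icc 0 (2 * p) :=
      ⟨hG0 ▸ hGm.monotone ht.1, hT ▸ hGm.monotone ht.2⟩
    simpa only [hc _ hmem] using hG t
  · simp [hG0]
  · simp [hG0, hpz]
  · simp [hG0]
  · have h0 : 0 < G t := hG0 ▸ hGm ht.1
    have h1 : G t < 2 * p := hT ▸ hGm ht.2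
    nlinarith [mul_pos h0 (sub_pos.2 h1)]
  · simp only [hT]
    ring
  · simp only [hT]
    have h4 : p ≤ p ^ 4 := le_self_pow₀ (by linarith) (by norm_num)
    linear_combination (2 / 3) * h4 + (2 / 3) * hpM.le - hpz + (1 / 3) * hM.le
end

section
/- For every z₀ > 0 there exist T > 0 and a solution (x, y, z) of the soliton ODE system on [0, T] with x(0) = 0, y(0) = 1, z(0) = z₀, such that x(t) > 0 for all t ∈ (0, T), x(T) = 0 and y(T) < 0. (That is, for every initial value z₀ > 0 the trajectory starting at (0, 1, z₀) returns to x = 0 at a first positive time, with strictly negative slope there.) -/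
/-- A scalar autonomous equation `w' = Q(w)` with `Q` continuous, positive and bounded has a
global solution through every initial value, and it is an order isomorphism of `ℝ`. -/
lemma exists_orderIso_hasDerivAt_of_pos_of_le {Q : ℝ → ℝ} {M : ℝ} (hQ : Continuous Q)
    (hpos : ∀ s, 0 < Q s) (hM : ∀ s, Q s ≤ M) (a : ℝ) :
    ∃ w : ℝ ≃o ℝ, w 0 = a ∧ ∀ t, HasDerivAt w (Q (w t)) t := by
  have hinv : Continuous fun s => (Q s)⁻¹ := hQ.inv₀ fun s => (hpos s).ne'
  set G : ℝ → ℝ := fun s => ∫ r in a..s, (Q r)⁻¹ with hG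
  have hGd : ∀ s, HasDerivAt G (Q s)⁻¹ s := fun s =>
    hinv.integral_hasStrictDerivAt a s |>.hasDerivAt
  have hGa : G a = 0 := by simp [hG]
  have hMpos : 0 < M := (hpos 0).trans_le (hM 0)
  have hGmono : StrictMono G := strictMono_of_hasDerivAt_pos hGd fun s => inv_pos.2 (hpos s)
  have hGc : Continuous G := continuous_iff_continuousAt.2 fun s => (hGd s).continuousAt
  have hdiff : Monotone fun s => G s - M⁻¹ * s := by
    have hd : ∀ s, HasDerivAt (fun s => G s - M⁻¹ * s) ((Q s)⁻¹ - M⁻¹) s := fun s =>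
      ((hGd s).sub ((hasDerivAt_id s).const_mul M⁻¹)).congr_deriv (by rw [mul_one])
    refine monotone_of_deriv_nonneg (fun s => (hd s).differentiableAt) fun s => ?_
    rw [(hd s).deriv, sub_nonneg]
    exact inv_anti₀ (hpos s) (hM s)
  have hline : ∀ c : ℝ, Function.Surjective fun s : ℝ => M⁻¹ * s + c := fun c b =>
    ⟨M * (b - c), by field_simp; ring⟩
  have hGs : Function.Surjective G := by
    intro b
    obtain ⟨s, hs⟩ := hline (-(M⁻¹ * a)) b
    simp only at hs
    rcases le_total a s with h | h
    · have h1 : b ≤ G s := by have := hdiff h; simp only [hGa] at this; linarith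
      have h2 : G a ≤ b := by
        have := mul_le_mul_of_nonneg_left h (inv_pos.2 hMpos).le; linarith
      exact mem_range_of_exists_le_of_exists_ge hGc ⟨a, h2⟩ ⟨s, h1⟩
    · have h1 : G s ≤ b := by have := hdiff h; simp only [hGa] at this; linarith
      have h2 : b ≤ G a := by
        have := mul_le_mul_of_nonneg_left h (inv_pos.2 hMpos).le; linarith
      exact mem_range_of_exists_le_of_exists_ge hGc ⟨s, h1⟩ ⟨a, h2⟩
  let e : ℝ ≃o ℝ := hGmono.orderIsoOfSurjective G hGs
  have he : ∀ s, e s = G s := fun s => rfl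
  refine ⟨e.symm, ?_, fun t => ?_⟩
  · rw [OrderIso.symm_apply_eq, he, hGa]
  · have := HasDerivAt.of_local_left_inverse (f := G) (g := e.symm) (a := t)
      e.symm.continuous.continuousAt (hGd _) (inv_pos.2 (hpos _)).ne'
      (Filter.Eventually.of_forall fun r => by rw [← he, e.apply_symm_apply])
    simpa using this

/-- Along trajectories with `x(0) = 0` and `u = y / z`, `u(0) = c`, the soliton system has the
first integrals `x = (c² - u²) / 2` and `z = k + (u - c)² (u + 2c) / 6`; conversely any solution of
`u' = -z(u)` yields a solution of the soliton system. -/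
lemma isSolitonODESolution_of_hasDerivAt {u : ℝ → ℝ} {c k : ℝ} {I : Set ℝ}
    (hu : ∀ t ∈ I, HasDerivAt u (-(k + (u t - c) ^ 2 * (u t + 2 * c) / 6)) t) :
    IsSolitonODESolution (fun t => (c ^ 2 - u t ^ 2) / 2)
      (fun t => u t * (k + (u t - c) ^ 2 * (u t + 2 * c) / 6))
      (fun t => k + (u t - c) ^ 2 * (u t + 2 * c) / 6) I := by
  intro t ht
  have h := hu t ht
  have hz := (((((h.sub_const c).pow 2).mul (h.add_const (2 * c))).div_const 6).const_add k)
  refine ⟨?_, ?_, ?_⟩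
  · refine (((h.pow 2).const_sub (c ^ 2)).div_const 2).congr_deriv ?_
    simp; ring
  · refine (h.mul hz).congr_deriv ?_
    simp; ring
  · refine hz.congr_deriv ?_
    simp; ring

/-- For every `z₀ > 0` the trajectory of the soliton ODE system starting at
`(0, 1, z₀)` returns to `x = 0` at a first positive time, with negative slope. -/
theorem soliton_ODE_return (z₀ : ℝ) (hz₀ : 0 < z₀) :
    ∃ (T : ℝ) (x y z : ℝ → ℝ), 0 < T ∧
      IsSolitonODESolution x y z (Set.Icc 0 T) ∧
      x 0 = 0 ∧ y 0 = 1 ∧ z 0 = z₀ ∧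
      (∀ t ∈ Set.Ioo 0 T, 0 < x t) ∧ x T = 0 ∧ y T < 0 := by
  set c : ℝ := z₀⁻¹
  have hc : 0 < c := inv_pos.2 hz₀
  have hcz : c * z₀ = 1 := inv_mul_cancel₀ hz₀.ne'
  set p : ℝ → ℝ := fun s => max (-c) (min s c) with hp
  have hpl : ∀ s, -c ≤ p s := fun s => le_max_left _ _
  have hpr : ∀ s, p s ≤ c := fun s => max_le (by linarith) (min_le_right _ _)
  have hpid : ∀ s, -c ≤ s → s ≤ c → p s = s := fun s h1 h2 => by
    simp [hp, min_eq_left h2, max_eq_right h1]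
  obtain ⟨w, hw0, hw⟩ := exists_orderIso_hasDerivAt_of_pos_of_le
    (Q := fun s => z₀ + (-p s - c) ^ 2 * (-p s + 2 * c) / 6) (M := z₀ + 2 * c ^ 3 / 3)
    (by fun_prop)
    (fun s => by
      have := mul_nonneg (sq_nonneg (-p s - c)) (by linarith [hpr s] : 0 ≤ -p s + 2 * c)
      linarith)
    (fun s => by
      have := mul_nonneg (sq_nonneg (-p s + c)) (by linarith [hpl s] : 0 ≤ 2 * c + p s)
      nlinarith)
    (-c)
  have hT : w (w.symm c) = c := w.apply_symm_apply c
  have hTpos : 0 < w.symm c := by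
    rw [← w.lt_iff_lt, hT, hw0]; linarith
  refine ⟨w.symm c, _, _, _, hTpos,
    isSolitonODESolution_of_hasDerivAt (u := fun t => -w t) (c := c) (k := z₀) ?_, ?_, ?_, ?_, ?_,
    ?_, ?_⟩
  · rintro t ⟨h0, h1⟩
    have hl := w.monotone h0
    have hr := w.monotone h1
    rw [hw0] at hl
    rw [hT] at hr
    have := (hw t).neg
    rwa [hpid _ hl hr] at this
  · simp [hw0]
  · simp [hw0, hcz]
  · simp [hw0]
  · rintro t ⟨h0, h1⟩
    have hl := w.strictMono h0
    have hr := w.strictMono h1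
    rw [hw0] at hl
    rw [hT] at hr
    nlinarith
  · simp [hT]
  · simp only [hT]
    have : 0 < z₀ + (-c - c) ^ 2 * (-c + 2 * c) / 6 := by
      have := mul_nonneg (sq_nonneg (-c - c)) (by linarith : 0 ≤ -c + 2 * c)
      linarith
    nlinarith
end

section
/- Let c > 0 and let (x, y, z) be a solution of the soliton ODE system on [0, T] with x(0) = 0, y(0) = 1, z(0) = c, x(t) > 0 for all t ∈ (0, T), x(T) = 0 and y(T) < 0. Then for every ε > 0 there exists δ > 0 such that every solution (x̃, ỹ, z̃) of the system with x̃(0) = 0, ỹ(0) = 1 and |z̃(0) − c| < δ, defined on a sufficiently long interval, has a first positive zero T̃ of x̃ satisfying |T̃ − T| < ε and |ỹ(T̃) − y(T)| < ε. (Continuity of the terminal slope at the first zero with respect to the initial value z₀, used in the intermediate value argument.) -/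
open Set Filter Topology

namespace SolitonODE

/-- The component `z` of the trajectory with `z 0 = a`, written in the rescaled time `s` with
`ds = z dt`. -/
noncomputable def profile (a s : ℝ) : ℝ := a + s ^ 2 / (2 * a) - s ^ 3 / 6

/-- The original time as a function of the rescaled time `τ` along the trajectory with `z 0 = a`.
The truncation is inactive for `τ ≤ 3 / a`. -/
noncomputable def elapsedTime (a τ : ℝ) : ℝ := ∫ s in (0 : ℝ)..τ, (max (profile a s) a)⁻¹

theorem continuous_profile (a : ℝ) : Continuous (profile a) := by
  unfold profile; fun_prop

theorem le_profile {a s : ℝ} (ha : 0 < a) (hs : s ≤ 2 / a) : a ≤ profile a s := by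
  have h : profile a s - a = s ^ 2 * ((3 / a - s) / 6) := by
    unfold profile; field_simp; ring
  have h3 : s ≤ 3 / a := hs.trans (by gcongr; norm_num)
  have : 0 ≤ s ^ 2 * ((3 / a - s) / 6) := mul_nonneg (sq_nonneg s) (by linarith)
  linarith

theorem hasDerivAt_elapsedTime {a : ℝ} (ha : 0 < a) (τ : ℝ) :
    HasDerivAt (elapsedTime a) (max (profile a τ) a)⁻¹ τ := by
  have hc : Continuous fun s => (max (profile a s) a)⁻¹ :=
    ((continuous_profile a).max continuous_const).inv₀
      fun s => (ha.trans_le (le_max_right _ _)).ne'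
  exact intervalIntegral.integral_hasDerivAt_right (hc.intervalIntegrable _ _)
    hc.stronglyMeasurable.stronglyMeasurableAtFilter hc.continuousAt

theorem elapsedTime_strictMono {a : ℝ} (ha : 0 < a) : StrictMono (elapsedTime a) :=
  strictMono_of_hasDerivAt_pos (hasDerivAt_elapsedTime ha)
    fun _ => inv_pos.2 (ha.trans_le (le_max_right _ _))

theorem continuousAt_elapsedTime_two_div {c : ℝ} (hc : 0 < c) :
    ContinuousAt (fun a => elapsedTime a (2 / a)) c := by
  have key : Continuous fun a : Ioi (0 : ℝ) => elapsedTime a (2 / a) := by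
    have hne : ∀ a : Ioi (0 : ℝ), (a : ℝ) ≠ 0 := fun a => (mem_Ioi.1 a.2).ne'
    refine intervalIntegral.continuous_parametric_intervalIntegral_of_continuous
      (f := fun (a : Ioi (0 : ℝ)) s => (max (profile a s) a)⁻¹) ?_ ?_
    · unfold profile Function.uncurry
      refine Continuous.inv₀ (Continuous.max ?_ (by fun_prop))
        fun p => ((mem_Ioi.1 p.1.2).trans_le (le_max_right _ _)).ne'
      refine Continuous.sub (Continuous.add (by fun_prop) (Continuous.div (by fun_prop)
        (by fun_prop) fun p => mul_ne_zero two_ne_zero (hne p.1))) (by fun_prop)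
    · exact continuous_const.div continuous_subtype_val hne
  exact (continuousOn_iff_continuous_domRestrict.2 key).continuousAt (Ioi_mem_nhds hc)

theorem eq_of_hasDerivAt_zero {f : ℝ → ℝ} {L : ℝ} (hf : ∀ t ∈ Icc 0 L, HasDerivAt f 0 t) :
    ∀ t ∈ Icc 0 L, f t = f 0 :=
  constant_of_has_deriv_right_zero
    (fun t ht => (hf t ht).continuousAt.continuousWithinAt)
    fun t ht => (hf t (Ico_subset_Icc_self ht)).hasDerivWithinAt

/-- A function satisfying a linear equation `z' = x z` keeps its sign. -/
theorem pos_of_hasDerivAt_mul {x z : ℝ → ℝ} {L : ℝ} (hx : ContinuousOn x (Icc 0 L))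
    (hz : ∀ t ∈ Icc 0 L, HasDerivAt z (x t * z t) t) (h0 : 0 < z 0) :
    ∀ t ∈ Icc 0 L, 0 < z t := by
  intro t ht
  have hL : (0 : ℝ) ≤ L := ht.1.trans ht.2
  have hc : Continuous (IccExtend hL ((Icc 0 L).domRestrict x)) :=
    hx.domRestrict.Icc_extend'
  set X : ℝ → ℝ := fun t => ∫ s in (0 : ℝ)..t, IccExtend hL ((Icc 0 L).domRestrict x) s with hX
  have hX' : ∀ t ∈ Icc 0 L, HasDerivAt X (x t) t := by
    intro t ht
    have := intervalIntegral.integral_hasDerivAt_right (hc.intervalIntegrable 0 t)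
      hc.stronglyMeasurable.stronglyMeasurableAtFilter hc.continuousAt
    rwa [IccExtend_of_mem hL _ ht] at this
  have h := eq_of_hasDerivAt_zero (f := fun t => z t * Real.exp (-X t)) (fun t ht => by
    refine ((hz t ht).mul (hX' t ht).neg.exp).congr_deriv ?_
    ring) t ht
  have hpos : 0 < z t * Real.exp (-X t) := by
    rw [h]; exact mul_pos h0 (Real.exp_pos _)
  exact pos_of_mul_pos_left hpos (Real.exp_pos _).le

/-- Explicit form of the trajectories of the soliton system in the rescaled time `τ`. -/
theorem exists_rescaledTime {a L : ℝ} (ha : 0 < a) {x y z : ℝ → ℝ}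
    (hsol : IsSolitonODESolution x y z (Icc 0 L)) (hx0 : x 0 = 0) (hy0 : y 0 = 1)
    (hz0 : z 0 = a) :
    ∃ τ : ℝ → ℝ, τ 0 = 0 ∧ ContinuousOn τ (Icc 0 L) ∧ StrictMonoOn τ (Icc 0 L) ∧
      ∀ t ∈ Icc 0 L, x t = τ t * (2 / a - τ t) / 2 ∧
        y t = profile a (τ t) * (1 / a - τ t) ∧
        (τ t ≤ 2 / a → elapsedTime a (τ t) = t) := by
  have hz : ∀ t ∈ Icc 0 L, 0 < z t :=
    pos_of_hasDerivAt_mul (fun t ht => (hsol t ht).1.continuousAt.continuousWithinAt)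
      (fun t ht => (hsol t ht).2.2) (hz0 ▸ ha)
  set τ : ℝ → ℝ := fun t => 1 / a - y t / z t with hτ
  have hτ0 : τ 0 = 0 := by simp [hτ, hy0, hz0]
  have hτ' : ∀ t ∈ Icc 0 L, HasDerivAt τ (z t) t := by
    intro t ht
    have hne := (hz t ht).ne'
    refine (((hsol t ht).2.1.div (hsol t ht).2.2 hne).const_sub (1 / a)).congr_deriv ?_
    field_simp
    ring
  have hτc : ContinuousOn τ (Icc 0 L) :=
    fun t ht => (hτ' t ht).continuousAt.continuousWithinAt
  have hτm : StrictMonoOn τ (Icc 0 L) := by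
    refine strictMonoOn_of_hasDerivWithinAt_pos (f' := z) (convex_Icc 0 L) hτc ?_ ?_
    · intro t ht
      exact (hτ' t (interior_subset ht)).hasDerivWithinAt
    · intro t ht
      exact hz t (interior_subset ht)
  have hyτ : ∀ t ∈ Icc 0 L, y t = z t * (1 / a - τ t) := by
    intro t ht
    have hne := (hz t ht).ne'
    simp only [hτ]
    field_simp
    ring
  have hxτ : ∀ t ∈ Icc 0 L, x t = τ t * (2 / a - τ t) / 2 := by
    intro t ht
    have h := eq_of_hasDerivAt_zero (f := fun t => x t - τ t * (2 / a - τ t) / 2)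
      (fun t ht => by
        refine ((hsol t ht).1.sub
          (((hτ' t ht).mul ((hτ' t ht).const_sub (2 / a))).div_const 2)).congr_deriv ?_
        rw [hyτ t ht]
        ring) t ht
    simp only [hx0, hτ0] at h
    linarith
  have hzτ : ∀ t ∈ Icc 0 L, z t = profile a (τ t) := by
    intro t ht
    have h := eq_of_hasDerivAt_zero (f := fun t => z t - (a + τ t ^ 2 / (2 * a) - τ t ^ 3 / 6))
      (fun t ht => by
        refine ((hsol t ht).2.2.sub (((((hτ' t ht).pow 2).div_const (2 * a)).const_add a).sub
          (((hτ' t ht).pow 3).div_const 6))).congr_deriv ?_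
        rw [hxτ t ht]
        field_simp
        ring) t ht
    norm_num [hz0, hτ0] at h
    unfold profile
    linarith
  refine ⟨τ, hτ0, hτc, hτm, fun t ht => ⟨hxτ t ht, hzτ t ht ▸ hyτ t ht, fun hle => ?_⟩⟩
  have h := eq_of_hasDerivAt_zero (f := fun s => elapsedTime a (τ s) - s) (L := t)
    (fun s hs => by
      have hs' : s ∈ Icc 0 L := ⟨hs.1, hs.2.trans ht.2⟩
      have hsle : τ s ≤ 2 / a := (hτm.monotoneOn hs' ht hs.2).trans hle
      refine (((hasDerivAt_elapsedTime ha (τ s)).comp s (hτ' s hs')).sub (hasDerivAt_id s)).congr_deriv ?_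
      rw [max_eq_left (le_profile ha hsle), ← hzτ s hs', inv_mul_cancel₀ (hz s hs').ne', sub_self])
    t ⟨ht.1, le_rfl⟩
  simp only [hτ0, elapsedTime, intervalIntegral.integral_same] at h
  unfold elapsedTime
  linarith

end SolitonODE

/-- Continuity of the first-return time and terminal slope with respect to the
initial value `z₀` of the soliton ODE system. -/
theorem soliton_ODE_continuous_dependence (c T : ℝ) (hc : 0 < c) (hT : 0 < T)
    (x y z : ℝ → ℝ)
    (hsol : IsSolitonODESolution x y z (Set.Icc 0 T))
    (hx0 : x 0 = 0) (hy0 : y 0 = 1) (hz0 : z 0 = c)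
    (hxpos : ∀ t ∈ Set.Ioo 0 T, 0 < x t) (hxT : x T = 0) (hyT : y T < 0) :
    ∀ ε : ℝ, 0 < ε → ∃ δ : ℝ, 0 < δ ∧ ∃ L : ℝ, T < L ∧
      ∀ x' y' z' : ℝ → ℝ, IsSolitonODESolution x' y' z' (Set.Icc 0 L) →
        x' 0 = 0 → y' 0 = 1 → |z' 0 - c| < δ →
        ∃ T' : ℝ, 0 < T' ∧ T' ≤ L ∧ x' T' = 0 ∧
          (∀ t ∈ Set.Ioo 0 T', 0 < x' t) ∧
          |T' - T| < ε ∧ |y' T' - y T| < ε := by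
  intro ε hε
  have hTeq : T = SolitonODE.elapsedTime c (2 / c) ∧
      y T = SolitonODE.profile c (2 / c) * (1 / c - 2 / c) := by
    obtain ⟨τ, hτ0, -, hτm, hτ⟩ := SolitonODE.exists_rescaledTime hc hsol hx0 hy0 hz0
    have hTm : T ∈ Icc 0 T := right_mem_Icc.2 hT.le
    obtain ⟨h1, h2, h3⟩ := hτ T hTm
    have hpos : 0 < τ T := hτ0 ▸ hτm (left_mem_Icc.2 hT.le) hTm hT
    have hτT : τ T = 2 / c := by
      rw [hxT] at h1
      have h : τ T * (2 / c - τ T) = 0 := by linarith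
      have := (mul_eq_zero.1 h).resolve_left hpos.ne'
      linarith
    rw [hτT] at h2 h3
    exact ⟨(h3 le_rfl).symm, h2⟩
  have hY : ContinuousAt (fun a : ℝ => SolitonODE.profile a (2 / a) * (1 / a - 2 / a)) c := by
    unfold SolitonODE.profile
    have := hc.ne'
    fun_prop (disch := positivity)
  have hev := (((SolitonODE.continuousAt_elapsedTime_two_div hc).eventually
    (Metric.ball_mem_nhds _ (lt_min hε one_pos))).and (hY.eventually
    (Metric.ball_mem_nhds _ hε))).and (Ioi_mem_nhds hc)
  obtain ⟨δ, hδ, hball⟩ := Metric.eventually_nhds_iff.1 hev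
  refine ⟨δ, hδ, T + 1, by linarith, fun x' y' z' hsol' hx0' hy0' hz0' => ?_⟩
  obtain ⟨⟨h1, h2⟩, h3⟩ := hball (y := z' 0) hz0'
  have ha : 0 < z' 0 := h3
  simp only [Real.dist_eq, ← hTeq.1] at h1
  simp only [Real.dist_eq, ← hTeq.2] at h2
  obtain ⟨τ, hτ0, hτc, hτm, hτ⟩ := SolitonODE.exists_rescaledTime ha hsol' hx0' hy0' rfl
  have hL : (0 : ℝ) ≤ T + 1 := by linarith
  have hlt : SolitonODE.elapsedTime (z' 0) (2 / z' 0) < T + 1 := by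
    have := (abs_lt.1 (h1.trans_le (min_le_right _ _))).2
    linarith
  have hreach : 2 / z' 0 ≤ τ (T + 1) := by
    by_contra! h
    have h4 := (hτ _ (right_mem_Icc.2 hL)).2.2 h.le
    have h5 := SolitonODE.elapsedTime_strictMono ha h
    linarith
  have hdiv : 0 < 2 / z' 0 := by positivity
  obtain ⟨T', hT', hτT'⟩ := intermediate_value_Icc hL hτc ⟨hτ0.trans_le hdiv.le, hreach⟩
  obtain ⟨h6, h7, h8⟩ := hτ T' hT'
  rw [hτT'] at h6 h7 h8
  have hTT' := h8 le_rfl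
  have hT'pos : 0 < T' := by
    refine hT'.1.lt_of_ne fun h => ?_
    rw [← h, hτ0] at hτT'
    exact hdiv.ne hτT'
  refine ⟨T', hT'pos, hT'.2, by rw [h6]; ring, fun t ht => ?_, ?_, by rwa [h7]⟩
  · have htm : t ∈ Icc 0 (T + 1) := ⟨ht.1.le, ht.2.le.trans hT'.2⟩
    rw [(hτ t htm).1]
    have h9 : 0 < τ t := hτ0 ▸ hτm (left_mem_Icc.2 hL) htm ht.1
    have h10 : τ t < 2 / z' 0 := hτT' ▸ hτm htm hT' ht.2
    have := mul_pos h9 (sub_pos.2 h10)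
    linarith
  · rw [← hTT']
    exact h1.trans_le (min_le_left _ _)
end

section
/- Let L > 0 and let φ, f : (0, L) → ℝ be twice differentiable with φ(r) > 0 for all r, and let γ : (0, L) → ℝ. Suppose that for all r ∈ (0, L): f″(r) − φ″(r)/φ(r) − γ(r)²/φ(r)² = 0 and φ′(r)·f′(r)/φ(r) − φ″(r)/φ(r) − γ(r)²/φ(r)² = 0. Then there exists a constant A ∈ ℝ such that f′(r) = A·φ(r) for all r ∈ (0, L), and consequently A·φ′(r) − φ″(r)/φ(r) − γ(r)²/φ(r)² = 0 for all r ∈ (0, L). -/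
/-- For a rotationally symmetric steady soliton with metric `dr² + φ(r)² dθ²`,
bundle curvature `γ(r) dr ∧ dθ` and radial potential `f`, the two component
equations of the soliton system force `f′ = A·φ` for a constant `A`, and hence
`A·φ′ − φ″/φ − γ²/φ² = 0`. -/
theorem rotationally_symmetric_soliton_reduction
    (L : ℝ) (hL : 0 < L) (φ φ' φ'' f f' f'' γ : ℝ → ℝ)
    (hφpos : ∀ r ∈ Set.Ioo (0:ℝ) L, 0 < φ r)
    (hφ' : ∀ r ∈ Set.Ioo (0:ℝ) L, HasDerivAt φ (φ' r) r)
    (hφ'' : ∀ r ∈ Set.Ioo (0:ℝ) L, HasDerivAt φ' (φ'' r) r)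
    (hf' : ∀ r ∈ Set.Ioo (0:ℝ) L, HasDerivAt f (f' r) r)
    (hf'' : ∀ r ∈ Set.Ioo (0:ℝ) L, HasDerivAt f' (f'' r) r)
    (heq1 : ∀ r ∈ Set.Ioo (0:ℝ) L,
      f'' r - φ'' r / φ r - (γ r) ^ 2 / (φ r) ^ 2 = 0)
    (heq2 : ∀ r ∈ Set.Ioo (0:ℝ) L,
      φ' r * f' r / φ r - φ'' r / φ r - (γ r) ^ 2 / (φ r) ^ 2 = 0) :
    ∃ A : ℝ, (∀ r ∈ Set.Ioo (0:ℝ) L, f' r = A * φ r) ∧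
      (∀ r ∈ Set.Ioo (0:ℝ) L,
        A * φ' r - φ'' r / φ r - (γ r) ^ 2 / (φ r) ^ 2 = 0) := by
  have hquot : ∀ r ∈ Set.Ioo (0:ℝ) L, HasDerivAt (fun x => f' x / φ x) 0 r := by
    intro r hr
    have hne : φ r ≠ 0 := (hφpos r hr).ne'
    have hf2 : f'' r = φ' r * f' r / φ r := by linarith [heq1 r hr, heq2 r hr]
    refine ((hf'' r hr).fun_div (hφ' r hr) hne).congr_deriv ?_
    rw [hf2]
    field_simp
    ring
  obtain ⟨A, hA⟩ := isOpen_Ioo.exists_is_const_of_deriv_eq_zero isPreconnected_Ioo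
    (fun r hr => (hquot r hr).differentiableAt.differentiableWithinAt)
    (fun r hr => (hquot r hr).deriv)
  have hfA : ∀ r ∈ Set.Ioo (0:ℝ) L, f' r = A * φ r := fun r hr =>
    (div_eq_iff (hφpos r hr).ne').mp (hA r hr)
  refine ⟨A, hfA, fun r hr => ?_⟩
  have hne : φ r ≠ 0 := (hφpos r hr).ne'
  have hterm : φ' r * f' r / φ r = A * φ' r := by
    rw [hfA r hr]
    field_simp
  rw [← hterm]
  exact heq2 r hr
end

section
/- Identify ℂ² with ℝ⁴ with coordinates (x₁, y₁, x₂, y₂), and fix a, b ∈ ℝ. Define the vector fields Z, E₁, E₂ : ℝ⁴ → ℝ⁴ by Z(p) = (a·y₁, −a·x₁, b·y₂, −b·x₂), E₁(p) = ((x₂² + y₂²)·y₁, −(x₂² + y₂²)·x₁, −(x₁² + y₁²)·y₂, (x₁² + y₁²)·x₂), and E₂(p) = ((x₂² + y₂²)·x₁, (x₂² + y₂²)·y₁, −(x₁² + y₁²)·x₂, −(x₁² + y₁²)·y₂). Then the Lie brackets [E₁, Z] and [E₂, Z] vanish identically on ℝ⁴, and the 1-form ω₀ = x₁ dy₁ −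 y₁ dx₁ + x₂ dy₂ − y₂ dx₂ annihilates E₁ and E₂ at every point, i.e. ω₀(E₁) = ω₀(E₂) = 0 everywhere. -/
/-- The Lie bracket of vector fields on `ℝ⁴`:
`[V, W](p) = DW(p)(V(p)) − DV(p)(W(p))`. -/
noncomputable def lieBracketR4 (V W : (Fin 4 → ℝ) → (Fin 4 → ℝ)) :
    (Fin 4 → ℝ) → (Fin 4 → ℝ) :=
  fun p => fderiv ℝ W p (V p) - fderiv ℝ V p (W p)

/-- The (scaled) Reeb vector field `Z = (a y₁, −a x₁, b y₂, −b x₂)`, in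
coordinates `p = (x₁, y₁, x₂, y₂)`. -/
def ZField (a b : ℝ) : (Fin 4 → ℝ) → (Fin 4 → ℝ) :=
  fun p => ![a * p 1, -(a * p 0), b * p 3, -(b * p 2)]

/-- The vector field `E₁ = (|z₂|² y₁, −|z₂|² x₁, −|z₁|² y₂, |z₁|² x₂)`. -/
def E1Field : (Fin 4 → ℝ) → (Fin 4 → ℝ) :=
  fun p => ![(p 2 ^ 2 + p 3 ^ 2) * p 1, -((p 2 ^ 2 + p 3 ^ 2) * p 0),
    -((p 0 ^ 2 + p 1 ^ 2) * p 3), (p 0 ^ 2 + p 1 ^ 2) * p 2]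

/-- The vector field `E₂ = J E₁ = (|z₂|² x₁, |z₂|² y₁, −|z₁|² x₂, −|z₁|² y₂)`. -/
def E2Field : (Fin 4 → ℝ) → (Fin 4 → ℝ) :=
  fun p => ![(p 2 ^ 2 + p 3 ^ 2) * p 0, (p 2 ^ 2 + p 3 ^ 2) * p 1,
    -((p 0 ^ 2 + p 1 ^ 2) * p 2), -((p 0 ^ 2 + p 1 ^ 2) * p 3)]

/-- The 1-form `ω₀ = x₁ dy₁ − y₁ dx₁ + x₂ dy₂ − y₂ dx₂` evaluated at `p` on a
tangent vector `v`. -/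
def omega0 (p v : Fin 4 → ℝ) : ℝ :=
  p 0 * v 1 - p 1 * v 0 + p 2 * v 3 - p 3 * v 2

theorem hasFDerivAt_coord (i : Fin 4) (p : Fin 4 → ℝ) :
    HasFDerivAt (fun q : Fin 4 → ℝ => q i) (ContinuousLinearMap.proj (R := ℝ) i) p :=
  hasFDerivAt_apply i p

/-- The Fréchet derivative of a map into `ℝ⁴` given by its four components. -/
theorem fderiv_vec4_apply {f₀ f₁ f₂ f₃ : (Fin 4 → ℝ) → ℝ}
    {f₀' f₁' f₂' f₃' : (Fin 4 → ℝ) →L[ℝ] ℝ} {p : Fin 4 → ℝ}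
    (h₀ : HasFDerivAt f₀ f₀' p) (h₁ : HasFDerivAt f₁ f₁' p)
    (h₂ : HasFDerivAt f₂ f₂' p) (h₃ : HasFDerivAt f₃ f₃' p) (v : Fin 4 → ℝ) :
    fderiv ℝ (fun q => ![f₀ q, f₁ q, f₂ q, f₃ q]) p v = ![f₀' v, f₁' v, f₂' v, f₃' v] := by
  have h : HasFDerivAt (fun q => ![f₀ q, f₁ q, f₂ q, f₃ q])
      (ContinuousLinearMap.pi ![f₀', f₁', f₂', f₃']) p := by
    rw [hasFDerivAt_pi']
    intro i
    fin_cases i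
    exacts [h₀, h₁, h₂, h₃]
  rw [h.fderiv]
  ext i
  fin_cases i <;> rfl

theorem fderiv_ZField_apply (a b : ℝ) (p v : Fin 4 → ℝ) :
    fderiv ℝ (ZField a b) p v = ZField a b v := by
  have c := fun i => hasFDerivAt_coord i p
  exact fderiv_vec4_apply ((c 1).const_mul a) ((c 0).const_mul a).neg
    ((c 3).const_mul b) ((c 2).const_mul b).neg v

theorem hasFDerivAt_sq_add_sq_mul (i j k : Fin 4) (p : Fin 4 → ℝ) :
    HasFDerivAt (fun q : Fin 4 → ℝ => (q i ^ 2 + q j ^ 2) * q k)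
      ((p i ^ 2 + p j ^ 2) • ContinuousLinearMap.proj (R := ℝ) (φ := fun _ => ℝ) k +
        p k • ((2 * p i) • ContinuousLinearMap.proj (R := ℝ) (φ := fun _ => ℝ) i +
          (2 * p j) • ContinuousLinearMap.proj (R := ℝ) (φ := fun _ => ℝ) j)) p := by
  refine ((((hasFDerivAt_coord i p).pow 2).add ((hasFDerivAt_coord j p).pow 2)).mul
    (hasFDerivAt_coord k p)).congr_fderiv ?_
  ext v
  simp

theorem fderiv_E1Field_apply (p v : Fin 4 → ℝ) :
    fderiv ℝ E1Field p v =
      ![(p 2 ^ 2 + p 3 ^ 2) * v 1 + 2 * (p 2 * v 2 + p 3 * v 3) * p 1,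
        -((p 2 ^ 2 + p 3 ^ 2) * v 0 + 2 * (p 2 * v 2 + p 3 * v 3) * p 0),
        -((p 0 ^ 2 + p 1 ^ 2) * v 3 + 2 * (p 0 * v 0 + p 1 * v 1) * p 3),
        (p 0 ^ 2 + p 1 ^ 2) * v 2 + 2 * (p 0 * v 0 + p 1 * v 1) * p 2] := by
  refine (fderiv_vec4_apply (hasFDerivAt_sq_add_sq_mul 2 3 1 p)
    (hasFDerivAt_sq_add_sq_mul 2 3 0 p).neg (hasFDerivAt_sq_add_sq_mul 0 1 3 p).neg
    (hasFDerivAt_sq_add_sq_mul 0 1 2 p) v).trans ?_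
  ext i
  fin_cases i <;> simp <;> ring

theorem fderiv_E2Field_apply (p v : Fin 4 → ℝ) :
    fderiv ℝ E2Field p v =
      ![(p 2 ^ 2 + p 3 ^ 2) * v 0 + 2 * (p 2 * v 2 + p 3 * v 3) * p 0,
        (p 2 ^ 2 + p 3 ^ 2) * v 1 + 2 * (p 2 * v 2 + p 3 * v 3) * p 1,
        -((p 0 ^ 2 + p 1 ^ 2) * v 2 + 2 * (p 0 * v 0 + p 1 * v 1) * p 2),
        -((p 0 ^ 2 + p 1 ^ 2) * v 3 + 2 * (p 0 * v 0 + p 1 * v 1) * p 3)] := by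
  refine (fderiv_vec4_apply (hasFDerivAt_sq_add_sq_mul 2 3 0 p)
    (hasFDerivAt_sq_add_sq_mul 2 3 1 p) (hasFDerivAt_sq_add_sq_mul 0 1 2 p).neg
    (hasFDerivAt_sq_add_sq_mul 0 1 3 p).neg v).trans ?_
  ext i
  fin_cases i <;> simp <;> ring

/-- The vector fields `E₁, E₂` commute with the Reeb field `Z`, and both are
annihilated by the contact form `ω₀ = σ·η_{α,β}`. -/
theorem contact_frame_properties (a b : ℝ) :
    (∀ p : Fin 4 → ℝ, lieBracketR4 E1Field (ZField a b) p = 0) ∧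
    (∀ p : Fin 4 → ℝ, lieBracketR4 E2Field (ZField a b) p = 0) ∧
    (∀ p : Fin 4 → ℝ, omega0 p (E1Field p) = 0) ∧
    (∀ p : Fin 4 → ℝ, omega0 p (E2Field p) = 0) := by
  refine ⟨fun p => ?_, fun p => ?_, fun p => ?_, fun p => ?_⟩
  · rw [lieBracketR4, fderiv_ZField_apply, fderiv_E1Field_apply]
    ext i
    fin_cases i <;> simp [ZField, E1Field] <;> ring
  · rw [lieBracketR4, fderiv_ZField_apply, fderiv_E2Field_apply]
    ext i
    fin_cases i <;> simp [ZField, E2Field] <;> ring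
  · simp [omega0, E1Field]
    ring
  · simp [omega0, E2Field]
    ring
end
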